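/- arXiv:math/0608419 — 7 statements merged into one kernel-verified Lean document; each statement's English description precedes it below -/
import Mathlib

section
/- The set of Keith numbers that are rep-digits is finite. That is, there are only finitely many positive integers of the form a·(10^n − 1)/9 with a ∈ {1,...,9} and n ≥ 2 that are Keith numbers. -/
/-- `keithList a m` is the list of the first `m` terms `K^N_1, …, K^N_m` of the Keith
sequence associated with the digit string `a = [a_1, …, a_n]` (most significant first):
`K^N_m = a_m` for `1 ≤ m ≤ n` and `K^N_m = K^N_{m-1} + ⋯ + K^N_{m-n}` for `m > n`. -/
def keithList (a : List ℕ) : ℕ → List ℕ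
  | 0 => []
  | m + 1 =>
      let prev := keithList a m
      prev ++ [if m < a.length then a.getD m 0 else (prev.drop (m - a.length)).sum]

/-- `keithSeq a m = K^N_m` (1-indexed; `keithSeq a 0 = 0` by convention). -/
def keithSeq (a : List ℕ) (m : ℕ) : ℕ := (keithList a m).getD (m - 1) 0

/-- A Keith number: a positive integer with at least 2 decimal digits that occurs in the
Keith sequence generated by its own decimal digits (most significant first). -/
def IsKeith (N : ℕ) : Prop :=
  2 ≤ (Nat.digits 10 N).length ∧
    ∃ m, 1 ≤ m ∧ keithSeq ((Nat.digits 10 N).reverse) m = N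

theorem length_keithList (L : List ℕ) (m : ℕ) : (keithList L m).length = m := by
  induction m with
  | zero => rfl
  | succ m ih => simp [keithList, ih]

theorem keithSeq_succ (L : List ℕ) (m : ℕ) :
    keithSeq L (m + 1) =
      if m < L.length then L.getD m 0 else ((keithList L m).drop (m - L.length)).sum := by
  have h := length_keithList L m
  simp only [keithSeq, keithList, Nat.add_sub_cancel]
  rw [List.getD_append_right _ _ _ _ h.le, h]
  simp

theorem keithList_succ (L : List ℕ) (m : ℕ) :
    keithList L (m + 1) = keithList L m ++ [keithSeq L (m + 1)] := by
  rw [keithSeq_succ, keithList]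

theorem keithList_eq_map (L : List ℕ) (m : ℕ) :
    keithList L m = (List.range m).map fun i => keithSeq L (i + 1) := by
  induction m with
  | zero => rfl
  | succ m ih => rw [keithList_succ, ih, List.range_succ, List.map_append]; rfl

theorem keithSeq_add_two (L : List ℕ) {m : ℕ} (hL : 1 ≤ L.length) (hm : L.length ≤ m) :
    keithSeq L (m + 2) + keithSeq L (m - L.length + 1) = 2 * keithSeq L (m + 1) := by
  have hlen := length_keithList L m
  have hlt : m - L.length < (keithList L m).length := by omega
  have h1 := keithSeq_succ L (m + 1)
  have h0 := keithSeq_succ L m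
  rw [if_neg (by omega)] at h0 h1
  rw [keithList_succ, List.drop_append_of_le_length (by omega), List.sum_append,
    List.sum_singleton, show m + 1 - L.length = m - L.length + 1 by omega, add_assoc] at h1
  rw [List.drop_eq_getElem_cons hlt, List.sum_cons] at h0
  have h2 : (keithList L m)[m - L.length] = keithSeq L (m - L.length + 1) := by
    simp [keithList_eq_map]
  rw [h2] at h0
  simp only [Nat.reduceAdd] at h1
  omega

theorem keithSeq_replicate_of_le (a : ℕ) {n m : ℕ} (h1 : 1 ≤ m) (hm : m ≤ n) :
    keithSeq (List.replicate n a) m = a := by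
  obtain ⟨m, rfl⟩ := Nat.exists_eq_add_of_le' h1
  have hlt : m < n := hm
  rw [keithSeq_succ, List.length_replicate, if_pos hlt]
  simp [hlt]

theorem keithSeq_replicate_length_succ (a n : ℕ) :
    keithSeq (List.replicate n a) (n + 1) = n * a := by
  rw [keithSeq_succ, List.length_replicate, if_neg (lt_irrefl n), Nat.sub_self, List.drop_zero,
    keithList_eq_map, List.map_congr_left (g := fun _ => a)]
  · simp
  · intro i hi
    exact keithSeq_replicate_of_le a (by omega) (List.mem_range.1 hi)

theorem digits_repdigit {a : ℕ} (n : ℕ) (h1 : 1 ≤ a) (h9 : a ≤ 9) :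
    Nat.digits 10 (a * ((10 ^ n - 1) / 9)) = List.replicate n a := by
  have key : ∀ k : ℕ, 9 * Nat.ofDigits 10 (List.replicate k a) + a = a * 10 ^ k := by
    intro k
    induction k with
    | zero => simp
    | succ k ih =>
      rw [List.replicate_succ, Nat.ofDigits_cons, pow_succ, ← mul_assoc, ← ih]
      ring
  have hdvd : 9 ∣ 10 ^ n - 1 := by simpa using Nat.sub_dvd_pow_sub_pow 10 1 n
  have hpos : 1 ≤ 10 ^ n := Nat.one_le_pow _ _ (by norm_num)
  obtain ⟨q, hq⟩ := hdvd
  have heq : a * ((10 ^ n - 1) / 9) = Nat.ofDigits 10 (List.replicate n a) := by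
    have hk := key n
    rw [show 10 ^ n = 9 * q + 1 by omega, mul_add, mul_left_comm] at hk
    rw [hq, Nat.mul_div_cancel_left _ (by norm_num)]
    omega
  rw [heq]
  refine Nat.digits_ofDigits 10 (by norm_num) _ ?_ ?_
  · intro l hl
    have := List.eq_of_mem_replicate hl
    omega
  · intro h
    rw [List.getLast_replicate]
    omega

/-- A sequence which vanishes on `1, …, n`, takes the value `d` at `n + 1`, and then satisfies the
recurrence `v (i + 1) = 2 * v i - v (i - n)`. -/
structure IsImpulse (n : ℕ) (d : ℤ) (v : ℕ → ℤ) : Prop where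
  eq_zero : ∀ i, 1 ≤ i → i ≤ n → v i = 0
  eq_start : v (n + 1) = d
  step : ∀ i, n + 1 ≤ i → v (i + 1) = 2 * v i - v (i - n)

theorem isImpulse_keithSeq_replicate (a : ℕ) {n : ℕ} (hn : 1 ≤ n) :
    IsImpulse n ((n - 1) * a) fun i => (keithSeq (List.replicate n a) i : ℤ) - a where
  eq_zero i h1 hi := by simp [keithSeq_replicate_of_le a h1 hi]
  eq_start := by
    rw [keithSeq_replicate_length_succ]
    push_cast
    ring
  step i hi := by
    obtain ⟨m, rfl⟩ := Nat.exists_eq_add_of_le' (show 1 ≤ i by omega)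
    have h := keithSeq_add_two (List.replicate n a) (m := m) (by simpa) (by simp; omega)
    rw [List.length_replicate, show m - n + 1 = m + 1 - n by omega] at h
    push_cast [show m + 1 + 1 = m + 2 by rfl]
    omega

namespace IsImpulse

variable {n : ℕ} {d : ℤ} {v : ℕ → ℤ}

theorem two_pow_dvd (h : IsImpulse n d v) {a : ℤ} (had : a ∣ d) (i : ℕ) (hi : 1 ≤ i) :
    a * 2 ^ (i % (n + 1)) ∣ v i := by
  induction i using Nat.strong_induction_on with
  | _ i ih =>
    rcases Nat.lt_or_ge n i with hni | hni
    · rcases Nat.eq_or_lt_of_le (show n + 1 ≤ i from hni) with rfl | hlt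
      · simpa [h.eq_start] using had
      · obtain ⟨k, rfl⟩ := Nat.exists_eq_add_of_le' hi
        have hk : k - n + (n + 1) = k + 1 := by omega
        have hprev := ih (k - n) (by omega) (by omega)
        rw [← Nat.add_mod_right, hk] at hprev
        rw [h.step k (by omega)]
        refine dvd_sub ?_ hprev
        have hk' := ih k (by omega) (by omega)
        refine dvd_trans ?_ (mul_dvd_mul_left 2 hk')
        rw [mul_left_comm, ← pow_succ']
        refine mul_dvd_mul_left a (pow_dvd_pow 2 ?_)
        rw [Nat.add_mod]
        refine (Nat.mod_le _ _).trans ?_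
        have := Nat.mod_le 1 (n + 1)
        omega
    · rw [h.eq_zero i hi hni]
      exact dvd_zero _

theorem nonneg_and_ratio (h : IsImpulse n d v) (hd : 0 ≤ d) (hn : 4 ≤ n) (i : ℕ) (hi : 1 ≤ i) :
    0 ≤ v i ∧ 15 * v i ≤ 8 * v (i + 1) := by
  induction i using Nat.strong_induction_on with
  | _ i ih =>
    rcases Nat.lt_or_ge n i with hni | hni
    · have hchain : ∀ j, 4 ≤ j → j < i → 8 * v (i - j) ≤ v i := by
        intro j hj
        induction j, hj using Nat.le_induction with
        | base =>
          intro h4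
          obtain ⟨k, rfl⟩ := Nat.exists_eq_add_of_le' h4.le
          have h0 := ih k (by omega) (by omega)
          have h1 := ih (k + 1) (by omega) (by omega)
          have h2 := ih (k + 2) (by omega) (by omega)
          have h3 := ih (k + 3) (by omega) (by omega)
          simp only [add_assoc, Nat.reduceAdd, Nat.add_sub_cancel] at *
          omega
        | succ j hj ihj =>
          intro hji
          have hj' := ihj (by omega)
          have hr := ih (i - (j + 1)) (by omega) (by omega)
          rw [show i - (j + 1) + 1 = i - j by omega] at hr
          omega
      have hc := hchain n hn hni
      have hs := h.step i hni
      have h0 := (ih (i - n) (by omega) (by omega)).1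
      omega
    · have h0 := h.eq_zero i hi hni
      rcases Nat.eq_or_lt_of_le hni with rfl | hlt
      · have := h.eq_start
        omega
      · have := h.eq_zero (i + 1) (by omega) hlt
        omega

theorem le_two_pow (h : IsImpulse n d v) (hd : 0 ≤ d) (hn : 4 ≤ n) (k : ℕ) :
    v (n + 1 + k) ≤ d * 2 ^ k := by
  induction k with
  | zero => simp [h.eq_start]
  | succ k ih =>
    have h0 := (h.nonneg_and_ratio hd hn (n + 1 + k - n) (by omega)).1
    rw [← add_assoc, h.step _ (by omega), pow_succ]
    linarith

theorem pow_mul_le (h : IsImpulse n d v) (hd : 0 ≤ d) (hn : 4 ≤ n) (k : ℕ) :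
    15 ^ k * d ≤ 8 ^ k * v (n + 1 + k) := by
  induction k with
  | zero => simp [h.eq_start]
  | succ k ih =>
    have hr := (h.nonneg_and_ratio hd hn (n + 1 + k) (by omega)).2
    have hp : (0 : ℤ) < 8 ^ k := by positivity
    rw [← add_assoc, pow_succ, pow_succ]
    nlinarith

theorem twelve_pow_le (h : IsImpulse n d v) (hd : 0 ≤ d) (hn : 4 ≤ n) {k : ℕ} (hk : 4 * n ≤ k) :
    12 ^ n * d ≤ v (n + 1 + k) := by
  induction k, hk using Nat.le_induction with
  | base =>
    have hp := h.pow_mul_le hd hn (4 * n)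
    have h15 : (12 : ℤ) ^ n * 8 ^ (4 * n) ≤ 15 ^ (4 * n) := by
      rw [pow_mul, pow_mul, ← mul_pow]
      exact pow_le_pow_left₀ (by norm_num) (by norm_num) n
    refine le_of_mul_le_mul_left ?_ (show (0 : ℤ) < 8 ^ (4 * n) by positivity)
    nlinarith
  | succ k hk ih =>
    have hr := h.nonneg_and_ratio hd hn (n + 1 + k) (by omega)
    rw [← add_assoc]
    omega

end IsImpulse

theorem mul_eight_pow_lt_ten_pow {n : ℕ} (hn : 60 ≤ n) :
    (9 * (n - 1) * 2 ^ (3 * n + 4) : ℤ) < 10 ^ n - 10 := by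
  have key : (9 * n * 16 * 8 ^ n + 10 : ℤ) < 10 ^ n := by
    induction n, hn using Nat.le_induction with
    | base => norm_num
    | succ n hn ih =>
      have hn' : (60 : ℤ) ≤ n := by exact_mod_cast hn
      have h8 : (0 : ℤ) < 8 ^ n := by positivity
      rw [pow_succ, pow_succ]
      push_cast
      nlinarith
  rw [pow_add, pow_mul]
  norm_num
  have h8 : (0 : ℤ) < 8 ^ n := by positivity
  nlinarith

theorem not_isKeith_repdigit {a n : ℕ} (h1 : 1 ≤ a) (h9 : a ≤ 9) (hn : 60 ≤ n) :
    ¬ IsKeith (a * ((10 ^ n - 1) / 9)) := by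
  rintro ⟨-, m, hm1, hm⟩
  rw [digits_repdigit n h1 h9, List.reverse_replicate] at hm
  have himp := isImpulse_keithSeq_replicate a (n := n) (by omega)
  set v : ℕ → ℤ := fun i => (keithSeq (List.replicate n a) i : ℤ) - a with hv
  have ha : (0 : ℤ) < a := by exact_mod_cast h1
  have hn' : (60 : ℤ) ≤ n := by exact_mod_cast hn
  have hdpos : (0 : ℤ) ≤ (n - 1) * a := by nlinarith
  have heq : 9 * v m = a * (10 ^ n - 10) := by
    have hdvd : 9 ∣ 10 ^ n - 1 := by simpa using Nat.sub_dvd_pow_sub_pow 10 1 n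
    have hpos : 1 ≤ 10 ^ n := Nat.one_le_pow _ _ (by norm_num)
    obtain ⟨q, hq⟩ := hdvd
    rw [hq, Nat.mul_div_cancel_left _ (by norm_num)] at hm
    have hq' : (10 : ℤ) ^ n = 9 * q + 1 := by
      have : 10 ^ n = 9 * q + 1 := by omega
      exact_mod_cast this
    simp only [hv, hm, hq']
    push_cast
    ring
  have hlarge := mul_eight_pow_lt_ten_pow hn
  rcases Nat.lt_or_ge n m with hnm | hmn
  · obtain ⟨k, rfl⟩ := Nat.exists_eq_add_of_le (show n + 1 ≤ m from hnm)
    rcases Nat.lt_or_ge (3 * n + 4) k with hk | hk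
    · rcases Nat.lt_or_ge k (4 * n + 4) with hk' | hk'
      · have hmod : (n + 1 + k) % (n + 1) = k - 3 * (n + 1) := by
          rw [show n + 1 + k = k - 3 * (n + 1) + (n + 1) * 4 by omega, Nat.add_mul_mod_self_left,
            Nat.mod_eq_of_lt (by omega)]
        have hdvd := himp.two_pow_dvd (dvd_mul_left (a : ℤ) (n - 1)) (n + 1 + k) (by omega)
        rw [hmod] at hdvd
        have h4 : (a : ℤ) * 2 ^ 2 ∣ (a : ℤ) * (10 ^ n - 10) := by
          rw [← heq]
          exact ((mul_dvd_mul_left _ (pow_dvd_pow 2 (by omega))).trans hdvd).mul_left 9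
        have h4' : (2 : ℤ) ^ 2 ∣ 10 ^ n - 10 := Int.dvd_of_mul_dvd_mul_left ha.ne' h4
        have h100 : (10 : ℤ) ^ 2 ∣ 10 ^ n := pow_dvd_pow 10 (by omega)
        omega
      · have hlow := himp.twelve_pow_le hdpos (by omega) (k := k) (by omega)
        have h12 : (10 : ℤ) ^ n ≤ 12 ^ n := pow_le_pow_left₀ (by norm_num) (by norm_num) n
        have h10 : (0 : ℤ) < 10 ^ n := by positivity
        have had : (a : ℤ) ≤ (n - 1) * a := by nlinarith
        have : (10 : ℤ) ^ n * a ≤ 12 ^ n * ((n - 1) * a) := by gcongr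
        nlinarith
    · have hup := himp.le_two_pow hdpos (by omega) k
      have hle : (2 : ℤ) ^ k ≤ 2 ^ (3 * n + 4) := pow_le_pow_right₀ (by norm_num) hk
      have := mul_le_mul_of_nonneg_left hle hdpos
      have := mul_lt_mul_of_pos_left hlarge ha
      linarith
  · rw [himp.eq_zero m hm1 hmn] at heq
    have := mul_lt_mul_of_pos_left hlarge ha
    have : (0 : ℤ) ≤ a * (9 * (n - 1) * 2 ^ (3 * n + 4)) := by
      have : (0 : ℤ) ≤ n - 1 := by linarith
      positivity
    linarith

/-- There are only finitely many Keith numbers which are rep-digits,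
i.e. of the form a·(10^n − 1)/9 with a ∈ {1,…,9} and n ≥ 2. -/
theorem keith_repdigits_finite :
    {N : ℕ | (∃ a n : ℕ, 1 ≤ a ∧ a ≤ 9 ∧ 2 ≤ n ∧ N = a * ((10 ^ n - 1) / 9)) ∧
      IsKeith N}.Finite := by
  refine (Set.finite_Iic (9 * 10 ^ 60)).subset ?_
  rintro N ⟨⟨a, n, h1, h9, -, rfl⟩, hN⟩
  have hn : n ≤ 60 := by
    by_contra! h
    exact not_isKeith_repdigit h1 h9 h.le hN
  have hpow : 10 ^ n ≤ 10 ^ 60 := Nat.pow_le_pow_right (by norm_num) hn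
  exact Nat.mul_le_mul h9 ((Nat.div_le_self _ _).trans ((Nat.sub_le _ _).trans hpow))
end

section
/- There is a constant C > 0 such that for every integer x ≥ 2, the number of Keith numbers in the interval [1, x] is at most C·x/√(log x). In particular, the set of Keith numbers has asymptotic density zero. -/
/-- The sequence with initial terms `a 0, …, a (n - 1)` in which every later term is the sum of the
preceding `n` terms. -/
def nStep (n : ℕ) (a : ℕ → ℕ) (k : ℕ) : ℕ :=
  if k < n then a k else ∑ t : Fin n, nStep n a (k - n + t)
termination_by k
decreasing_by omega

lemma nStep_of_lt {n k : ℕ} (a : ℕ → ℕ) (h : k < n) : nStep n a k = a k := by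
  rw [nStep, if_pos h]

lemma nStep_of_le {n k : ℕ} (a : ℕ → ℕ) (h : n ≤ k) :
    nStep n a k = ∑ t ∈ Finset.range n, nStep n a (k - n + t) := by
  rw [nStep, if_neg h.not_gt, Finset.sum_range]

lemma nStep_eq_sum_Ico {n k : ℕ} (a : ℕ → ℕ) (h : n ≤ k) :
    nStep n a k = ∑ t ∈ Finset.Ico (k - n) k, nStep n a t := by
  rw [nStep_of_le a h, Finset.sum_Ico_eq_sum_range, Nat.sub_sub_self h]

lemma nStep_eq_sum_mul (n : ℕ) (a : ℕ → ℕ) (k : ℕ) :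
    nStep n a k = ∑ i ∈ Finset.range n, a i * nStep n (Pi.single i 1) k := by
  induction k using Nat.strong_induction_on with
  | _ k ih =>
    rcases lt_or_ge k n with h | h
    · simp only [nStep_of_lt _ h, Pi.single_apply]
      simp [h]
    · simp only [nStep_of_le _ h, Finset.mul_sum]
      rw [Finset.sum_comm]
      refine Finset.sum_congr rfl fun t ht ↦ ih _ ?_
      rw [Finset.mem_range] at ht
      omega

/-- Domination of the tail sums of the initial terms gives domination of all later terms. -/
lemma nStep_le_nStep {n : ℕ} {a b : ℕ → ℕ}
    (hab : ∀ m, ∑ t ∈ Finset.Ico m n, a t ≤ ∑ t ∈ Finset.Ico m n, b t) {k : ℕ} (hk : n ≤ k) :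
    nStep n a k ≤ nStep n b k := by
  induction k using Nat.strong_induction_on with
  | _ k ih =>
    rw [nStep_eq_sum_Ico a hk, nStep_eq_sum_Ico b hk]
    rcases le_total n (k - n) with h | h
    · refine Finset.sum_le_sum fun t ht ↦ ih t ?_ ?_ <;> rw [Finset.mem_Ico] at ht <;> omega
    · rw [← Finset.sum_Ico_consecutive _ h hk, ← Finset.sum_Ico_consecutive _ h hk]
      refine add_le_add ?_ (Finset.sum_le_sum fun t ht ↦ ih t ?_ ?_)
      · rw [Finset.sum_congr rfl fun t ht ↦ nStep_of_lt a (Finset.mem_Ico.1 ht).2,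
          Finset.sum_congr rfl fun t ht ↦ nStep_of_lt b (Finset.mem_Ico.1 ht).2]
        exact hab _
      all_goals rw [Finset.mem_Ico] at ht; omega

lemma nStep_single_mono {n i j k : ℕ} (hij : i ≤ j) (hj : j < n) (hk : n ≤ k) :
    nStep n (Pi.single i 1) k ≤ nStep n (Pi.single j 1) k := by
  refine nStep_le_nStep (fun m ↦ ?_) hk
  simp only [Pi.single_apply, Finset.sum_ite_eq', Finset.mem_Ico]
  split_ifs <;> omega

lemma nStep_single_last {n : ℕ} (hn : 2 ≤ n) (k : ℕ) :
    nStep n (Pi.single (n - 1) 1) k = nStep n (Pi.single 0 1) (k + 1) := by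
  induction k using Nat.strong_induction_on with
  | _ k ih =>
    rcases lt_or_ge k n with h | h
    · rcases eq_or_ne k (n - 1) with rfl | hne
      · rw [nStep_of_lt _ h, nStep_of_le _ (by omega), Finset.sum_congr rfl fun t ht ↦
          nStep_of_lt _ (by rw [Finset.mem_range] at ht; omega)]
        simp only [Pi.single_apply]
        rw [Finset.sum_eq_single_of_mem 0 (by simp; omega)]
        · simp; omega
        · intro t _ ht
          simp [ht]
      · rw [nStep_of_lt _ h, nStep_of_lt _ (by omega)]
        simp [hne]
    · rw [nStep_of_le _ h, nStep_of_le _ (by omega)]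
      refine Finset.sum_congr rfl fun t ht ↦ ?_
      rw [Finset.mem_range] at ht
      rw [ih _ (by omega)]
      congr 1
      omega

lemma nStep_succ_le_two_mul {n k : ℕ} (a : ℕ → ℕ) (hn : 2 ≤ n) (hk : n ≤ k) :
    nStep n a (k + 1) ≤ 2 * nStep n a k := by
  rw [nStep_eq_sum_Ico a (by omega : n ≤ k + 1), Finset.sum_Ico_succ_top (by omega), two_mul]
  gcongr
  conv_rhs => rw [nStep_eq_sum_Ico a hk]
  exact Finset.sum_le_sum_of_subset (Finset.Ico_subset_Ico (by omega) le_rfl)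

lemma two_mul_nStep_le {n k : ℕ} (a : ℕ → ℕ) (hn : 2 ≤ n) (hk : n ≤ k) :
    2 * nStep n a k ≤ nStep n a (k + 2) := by
  have h1 : nStep n a k ≤ nStep n a (k + 1) := by
    rw [nStep_eq_sum_Ico a (by omega : n ≤ k + 1)]
    exact Finset.single_le_sum (f := nStep n a) (fun _ _ ↦ Nat.zero_le _) (by simp; omega)
  have h2 : nStep n a k + nStep n a (k + 1) ≤ nStep n a (k + 2) := by
    rw [nStep_eq_sum_Ico a (by omega : n ≤ k + 2), Finset.sum_Ico_succ_top (by omega)]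
    gcongr
    exact Finset.single_le_sum (f := nStep n a) (fun _ _ ↦ Nat.zero_le _) (by simp; omega)
  omega

lemma two_pow_mul_nStep_le {n k : ℕ} (a : ℕ → ℕ) (hn : 2 ≤ n) (hk : n ≤ k) (r : ℕ) :
    2 ^ r * nStep n a k ≤ nStep n a (k + 2 * r) := by
  induction r with
  | zero => simp
  | succ r ih =>
    have := two_mul_nStep_le a hn (by omega : n ≤ k + 2 * r)
    rw [pow_succ, show k + 2 * (r + 1) = k + 2 * r + 2 by ring]
    linarith

lemma nStep_le_of_le {n k l : ℕ} (a : ℕ → ℕ) (hn : 2 ≤ n) (hk : n ≤ k) (hkl : k ≤ l) :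
    nStep n a k ≤ nStep n a l := by
  induction l, hkl using Nat.le_induction with
  | base => rfl
  | succ l hl ih =>
    refine ih.trans ?_
    rw [nStep_eq_sum_Ico a (by omega : n ≤ l + 1)]
    exact Finset.single_le_sum (f := nStep n a) (fun _ _ ↦ Nat.zero_le _) (by simp; omega)

lemma sum_mul_le_nStep {n k : ℕ} (a : ℕ → ℕ) (hk : n ≤ k) :
    (∑ i ∈ Finset.range n, a i) * nStep n (Pi.single 0 1) k ≤ nStep n a k := by
  rw [nStep_eq_sum_mul n a, Finset.sum_mul]
  refine Finset.sum_le_sum fun i hi ↦ ?_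
  gcongr
  exact nStep_single_mono (Nat.zero_le i) (Finset.mem_range.1 hi) hk

lemma nStep_le_sum_mul {n k : ℕ} (a : ℕ → ℕ) (hn : 2 ≤ n) (hk : n ≤ k) :
    nStep n a k ≤ (∑ i ∈ Finset.range n, a i) * (2 * nStep n (Pi.single 0 1) k) := by
  rw [nStep_eq_sum_mul n a, Finset.sum_mul]
  refine Finset.sum_le_sum fun i hi ↦ ?_
  rw [Finset.mem_range] at hi
  gcongr
  calc nStep n (Pi.single i 1) k ≤ nStep n (Pi.single (n - 1) 1) k :=
        nStep_single_mono (by omega) (by omega) hk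
    _ = nStep n (Pi.single 0 1) (k + 1) := nStep_single_last hn k
    _ ≤ _ := nStep_succ_le_two_mul _ hn hk

/-- Only boundedly many terms of the sequence with first term `1` have the size of `y / n`. -/
lemma exists_window (n y : ℕ) (hn : 2 ≤ n) : ∃ k₀, ∀ k, n ≤ k →
    n * nStep n (Pi.single 0 1) k < y → y ≤ 180 * n * nStep n (Pi.single 0 1) k →
      k ∈ Finset.Ico k₀ (k₀ + 16) := by
  set u := nStep n (Pi.single 0 1) with hu
  by_cases hex : ∃ k, n ≤ k ∧ n * u k < y ∧ y ≤ 180 * n * u k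
  · classical
    refine ⟨Nat.find hex, fun k hk h1 h2 ↦ ?_⟩
    obtain ⟨hk0, -, h3⟩ := Nat.find_spec hex
    have hle := Nat.find_min' hex ⟨hk, h1, h2⟩
    rw [Finset.mem_Ico]
    refine ⟨hle, ?_⟩
    by_contra! hlt
    have h4 := two_pow_mul_nStep_le (Pi.single 0 1) hn hk0 8
    have h5 := nStep_le_of_le (Pi.single 0 1) hn (by omega) hlt
    rw [← hu] at h4 h5
    have h6 : n * (2 ^ 8 * u (Nat.find hex)) ≤ n * u k := Nat.mul_le_mul_left _ (h4.trans h5)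
    nlinarith
  · push Not at hex
    exact ⟨0, fun k hk h1 h2 ↦ absurd h2 (hex k hk h1).not_ge⟩

lemma keithList_eq_map_s1 (a : List ℕ) (m : ℕ) :
    keithList a m = (List.range m).map (nStep a.length (a.getD · 0)) := by
  induction m with
  | zero => rfl
  | succ m ih =>
    rw [List.range_succ, List.map_append, List.map_singleton, keithList]
    simp only [ih]
    congr 2
    split_ifs with h
    · rw [nStep_of_lt _ h]
    · rw [nStep_of_le _ (not_lt.1 h), ← List.map_drop, List.range_eq_range', List.drop_range',
        List.range'_eq_map_range, List.map_map, Nat.sub_sub_self (not_lt.1 h)]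
      simp [Finset.sum_range, ← List.sum_ofFn, List.ofFn_eq_map, ← List.map_coe_finRange_eq_range,
        Function.comp_def]

lemma keithSeq_succ_s1 (a : List ℕ) (k : ℕ) :
    keithSeq a (k + 1) = nStep a.length (a.getD · 0) k := by
  simp [keithSeq, keithList_eq_map_s1, List.getD_eq_getElem?_getD]

/-- The Littlewood–Offord bound for subset sums of nonzero integers. -/
lemma card_subset_sum_eq_le {n : ℕ} (w : Fin n → ℤ) (hw : ∀ i, w i ≠ 0) (c : ℤ) :
    ({A : Finset (Fin n) | ∑ i ∈ A, w i = c} : Finset _).card ≤ n.choose (n / 2) := by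
  classical
  set M : Finset (Fin n) := {i | w i < 0} with hM
  set F : Finset (Finset (Fin n)) := {A | ∑ i ∈ A, w i = c} with hF
  have hsum (A : Finset (Fin n)) :
      ∑ i ∈ symmDiff A M, |w i| = ∑ i ∈ A, w i - ∑ i ∈ M, w i := by
    rw [← Fintype.sum_ite_mem, ← Fintype.sum_ite_mem A, ← Fintype.sum_ite_mem M,
      ← Finset.sum_sub_distrib]
    refine Finset.sum_congr rfl fun i _ ↦ ?_
    have hiM : i ∈ M ↔ w i < 0 := by simp [hM]
    simp only [Finset.mem_symmDiff, hiM]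
    rcases lt_or_ge (w i) 0 with h | h
    · by_cases hA : i ∈ A <;> simp [hA, h, abs_of_neg h]
    · by_cases hA : i ∈ A <;> simp [hA, h.not_gt, abs_of_nonneg h]
  have hanti : IsAntichain (· ⊆ ·) (F.image (symmDiff · M) : Set (Finset (Fin n))) := by
    intro S hS T hT hne hST
    simp only [Finset.coe_image, Set.mem_image, Finset.mem_coe, hF, Finset.mem_filter,
      Finset.mem_univ, true_and] at hS hT
    obtain ⟨A, hA, rfl⟩ := hS
    obtain ⟨B, hB, rfl⟩ := hT
    obtain ⟨i, hi, hi'⟩ := Finset.exists_of_ssubset (hST.ssubset_of_ne hne)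
    have := Finset.sum_lt_sum_of_subset (f := fun i ↦ |w i|) hST hi hi' (abs_pos.2 (hw i))
      fun _ _ _ ↦ abs_nonneg _
    rw [hsum, hsum, hA, hB] at this
    exact this.false
  rw [← Finset.card_image_of_injective F (symmDiff_left_injective M)]
  simpa using hanti.sperner

lemma card_digits_eq_le {n : ℕ} (w : Fin n → ℤ) (hw : ∀ i, w i ≠ 0) (c : ℤ) :
    ({a : Fin n → Fin 10 | ∑ i, w i * (a i : ℕ) = c} : Finset _).card
      ≤ n.choose (n / 2) * 5 ^ n := by
  classical
  have key := Finset.card_le_mul_card_image_of_maps_to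
    (s := ({a : Fin n → Fin 10 | ∑ i, w i * (a i : ℕ) = c} : Finset _))
    (f := fun a i ↦ (⟨(a i : ℕ) / 2, by omega⟩ : Fin 5)) (t := Finset.univ)
    (fun _ _ ↦ Finset.mem_univ _) (n.choose (n / 2)) ?_
  · simpa using key
  intro b _
  refine le_trans ?_ (card_subset_sum_eq_le w hw (c - ∑ i, w i * (2 * (b i : ℕ))))
  refine Finset.card_le_card_of_injOn (fun a ↦ Finset.univ.filter fun i ↦ (a i : ℕ) % 2 = 1) ?_ ?_
  · intro a ha
    simp only [Finset.coe_filter, Finset.mem_filter, Finset.mem_univ, true_and,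
      Set.mem_ofPred_eq] at ha ⊢
    obtain ⟨hs, rfl⟩ := ha
    rw [← hs, Finset.sum_filter, ← Finset.sum_sub_distrib]
    refine Finset.sum_congr rfl fun i _ ↦ ?_
    have h : ((a i : ℕ) : ℤ) = 2 * ((a i : ℕ) / 2 : ℕ) + ((a i : ℕ) % 2 : ℕ) := by omega
    rw [← mul_sub, h]
    rcases Nat.mod_two_eq_zero_or_one (a i) with h' | h' <;> simp [h']
  · intro a ha a' ha' haa
    simp only [Finset.coe_filter, Finset.mem_filter, Finset.mem_univ, true_and,
      Set.mem_ofPred_eq] at ha ha'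
    funext i
    have h1 := congr_arg Fin.val (congr_fun (ha.2.trans ha'.2.symm) i)
    have h2 := Finset.ext_iff.1 haa i
    simp only [Finset.mem_filter, Finset.mem_univ, true_and] at h2
    dsimp only at h1
    ext
    omega

lemma card_digits_eq_le_of_ne {n : ℕ} (w : Fin n → ℤ) (j : Fin n) (hw : ∀ i, i ≠ j → w i ≠ 0)
    (c : ℤ) :
    ({a : Fin n → Fin 10 | ∑ i, w i * (a i : ℕ) = c} : Finset _).card
      ≤ n.choose (n / 2) * 5 ^ n * 10 := by
  classical
  have key := Finset.card_le_mul_card_image_of_maps_to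
    (s := ({a : Fin n → Fin 10 | ∑ i, w i * (a i : ℕ) = c} : Finset _))
    (f := fun a ↦ a j) (t := Finset.univ)
    (fun _ _ ↦ Finset.mem_univ _) (n.choose (n / 2) * 5 ^ n) ?_
  · simpa using key
  intro d _
  refine le_trans (Finset.card_le_card ?_) (card_digits_eq_le (Function.update w j 1) ?_
    (c - w j * (d : ℕ) + (d : ℕ)))
  · intro a ha
    simp only [Finset.mem_filter, Finset.mem_univ, true_and] at ha ⊢
    obtain ⟨hs, rfl⟩ := ha
    rw [← hs, ← Finset.add_sum_erase _ _ (Finset.mem_univ j),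
      ← Finset.add_sum_erase _ (fun i ↦ w i * _) (Finset.mem_univ j),
      Finset.sum_congr rfl fun i hi ↦ by
        rw [Function.update_of_ne (Finset.ne_of_mem_erase hi)]]
    simp
    ring
  · intro i
    rcases eq_or_ne i j with rfl | h
    · simp
    · simpa [h] using hw i h

lemma card_sum_digits_lt_le (n : ℕ) :
    ({a : Fin n → Fin 10 | ∑ i, (a i : ℕ) < n} : Finset _).card ≤ 4 ^ n := by
  have h : (({a : Fin n → Fin 10 | ∑ i, (a i : ℕ) < n} : Finset _).card : ℚ) ≤ 4 ^ n := by
    calc (({a : Fin n → Fin 10 | ∑ i, (a i : ℕ) < n} : Finset _).card : ℚ)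
        = ∑ a : Fin n → Fin 10 with ∑ i, (a i : ℕ) < n, 1 := by simp
      _ ≤ ∑ a : Fin n → Fin 10 with ∑ i, (a i : ℕ) < n, 2 ^ n * ∏ i, (1 / 2 : ℚ) ^ (a i : ℕ) := by
          refine Finset.sum_le_sum fun a ha ↦ ?_
          simp only [Finset.mem_filter, Finset.mem_univ, true_and] at ha
          rw [Finset.prod_pow_eq_pow_sum, one_div, inv_pow, ← div_eq_mul_inv,
            one_le_div (by positivity)]
          exact pow_le_pow_right₀ (by norm_num) ha.le
      _ ≤ ∑ a : Fin n → Fin 10, 2 ^ n * ∏ i, (1 / 2 : ℚ) ^ (a i : ℕ) :=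
          Finset.sum_le_sum_of_subset_of_nonneg (Finset.filter_subset _ _)
            fun _ _ _ ↦ by positivity
      _ = 2 ^ n * (∑ d : Fin 10, (1 / 2 : ℚ) ^ (d : ℕ)) ^ n := by
          rw [Fintype.sum_pow, Finset.mul_sum]
      _ ≤ 2 ^ n * 2 ^ n := by
          gcongr
          norm_num [Fin.sum_univ_succ]
      _ = 4 ^ n := by rw [← mul_pow]; norm_num
  exact_mod_cast h

lemma centralBinom_sq_mul_le (n : ℕ) : n.centralBinom ^ 2 * (2 * n + 1) ≤ 16 ^ n := by
  induction n with
  | zero => simp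
  | succ n ih =>
    have h := Nat.succ_mul_centralBinom_succ n
    refine Nat.le_of_mul_le_mul_left (?_ : (n + 1) ^ 2 * _ ≤ (n + 1) ^ 2 * _) (by positivity)
    calc (n + 1) ^ 2 * ((n + 1).centralBinom ^ 2 * (2 * (n + 1) + 1))
        = ((n + 1) * (n + 1).centralBinom) ^ 2 * (2 * n + 3) := by ring
      _ = n.centralBinom ^ 2 * (2 * n + 1) * (4 * ((2 * n + 1) * (2 * n + 3))) := by rw [h]; ring
      _ ≤ 16 ^ n * (4 * (4 * (n + 1) ^ 2)) := Nat.mul_le_mul ih (by nlinarith)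
      _ = _ := by ring

lemma choose_half_sq_mul_le (n : ℕ) : n.choose (n / 2) ^ 2 * n ≤ 4 ^ n := by
  obtain ⟨k, rfl | rfl⟩ := Nat.even_or_odd' n
  · have h := centralBinom_sq_mul_le k
    rw [Nat.mul_div_cancel_left k two_pos, ← Nat.centralBinom_eq_two_mul_choose, pow_mul]
    norm_num
    nlinarith [sq_nonneg k.centralBinom]
  · have h := centralBinom_sq_mul_le (k + 1)
    have h2 : (k + 1).centralBinom = 2 * (2 * k + 1).choose k := by
      rw [Nat.centralBinom_eq_two_mul_choose, show 2 * (k + 1) = 2 * k + 1 + 1 by ring,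
        Nat.choose_succ_succ, ← Nat.choose_symm_half k]
      ring
    rw [h2] at h
    rw [show (2 * k + 1) / 2 = k by omega, pow_succ 4 (2 * k), pow_mul]
    rw [pow_succ 16 k] at h
    norm_num
    nlinarith [sq_nonneg ((2 * k + 1).choose k)]

lemma choose_half_le {n : ℕ} (hn : 0 < n) : (n.choose (n / 2) : ℝ) ≤ 2 ^ n / √n := by
  rw [le_div_iff₀ (by positivity)]
  refine le_of_sq_le_sq ?_ (by positivity)
  rw [mul_pow, Real.sq_sqrt (by positivity), ← pow_mul, mul_comm n 2, pow_mul]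
  have := choose_half_sq_mul_le n
  norm_num
  exact_mod_cast this

lemma sum_div_pow_mod_mul_pow (N n : ℕ) :
    ∑ i ∈ Finset.range n, N / 10 ^ i % 10 * 10 ^ i = N % 10 ^ n := by
  induction n with
  | zero => simp [Nat.mod_one]
  | succ n ih => rw [Finset.sum_range_succ, ih, Nat.mod_pow_succ, mul_comm (10 ^ n)]

lemma getD_reverse_digits {N i : ℕ} (hi : i < (Nat.digits 10 N).length) :
    (Nat.digits 10 N).reverse.getD i 0 = N / 10 ^ ((Nat.digits 10 N).length - 1 - i) % 10 := by
  rw [List.getD_reverse i hi, Nat.getD_digits _ _ (by norm_num)]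

/-- The coefficients of the linear relation among the digits that expresses that a number with `n`
digits equals the term of index `k` of its Keith sequence. -/
def keithWeight (n k : ℕ) (i : Fin n) : ℤ :=
  10 ^ (n - 1 - (i : ℕ)) - (nStep n (Pi.single (i : ℕ) 1) k : ℤ)

lemma keithWeight_strictAnti {n k : ℕ} (hk : n ≤ k) : StrictAnti (keithWeight n k) := by
  intro i j hij
  have h1 : (10 : ℤ) ^ (n - 1 - (j : ℕ)) < 10 ^ (n - 1 - (i : ℕ)) :=
    pow_lt_pow_right₀ (by norm_num) (by omega)
  have h2 : (nStep n (Pi.single (i : ℕ) 1) k : ℤ) ≤ nStep n (Pi.single (j : ℕ) 1) k := by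
    exact_mod_cast nStep_single_mono hij.le j.isLt hk
  unfold keithWeight
  linarith

lemma card_keithWeight_le {n k : ℕ} (hn : 2 ≤ n) (hk : n ≤ k) :
    ({a : Fin n → Fin 10 | ∑ i, keithWeight n k i * (a i : ℕ) = 0} : Finset _).card
      ≤ n.choose (n / 2) * 5 ^ n * 10 := by
  obtain ⟨j, hj⟩ : ∃ j, ∀ i, i ≠ j → keithWeight n k i ≠ 0 := by
    by_cases h : ∃ j, keithWeight n k j = 0
    · obtain ⟨j, hj⟩ := h
      exact ⟨j, fun i hij hi ↦ hij ((keithWeight_strictAnti hk).injective (hi.trans hj.symm))⟩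
    · push Not at h
      exact ⟨⟨0, by omega⟩, fun i _ ↦ h i⟩
  exact card_digits_eq_le_of_ne _ j hj 0

/-- The leading-digit-first digits of a Keith number with `n` digits either have a small sum or
satisfy one of boundedly many linear relations. -/
lemma exists_digits_of_isKeith {n k₀ : ℕ} (hn : 2 ≤ n)
    (hk₀ : ∀ k, n ≤ k → n * nStep n (Pi.single 0 1) k < 10 ^ n →
      10 ^ n ≤ 180 * n * nStep n (Pi.single 0 1) k → k ∈ Finset.Ico k₀ (k₀ + 16))
    {N : ℕ} (hN : IsKeith N) (hlen : (Nat.digits 10 N).length = n) :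
    ∃ a : Fin n → Fin 10, ∑ i, (a i : ℕ) * 10 ^ (n - 1 - (i : ℕ)) = N ∧
      (∑ i, (a i : ℕ) < n ∨ ∃ k ∈ Finset.Ico k₀ (k₀ + 16), n ≤ k ∧
        ∑ i, keithWeight n k i * (a i : ℕ) = 0) := by
  obtain ⟨-, m, hm, hkm⟩ := hN
  obtain ⟨k, rfl⟩ : ∃ k, m = k + 1 := ⟨m - 1, by omega⟩
  set d : ℕ → ℕ := fun i ↦ (Nat.digits 10 N).reverse.getD i 0 with hd
  have hdi (i : ℕ) (hi : i < n) : d i = N / 10 ^ (n - 1 - i) % 10 := by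
    rw [hd, ← hlen]
    exact getD_reverse_digits (by omega)
  rw [keithSeq_succ_s1, List.length_reverse, hlen] at hkm
  change nStep n d k = N at hkm
  have hlt : N < 10 ^ n := hlen ▸ Nat.lt_base_pow_length_digits (by norm_num)
  have hN0 : N ≠ 0 := by
    rintro rfl
    simp at hlen
    omega
  have hge : 10 ^ n ≤ 10 * N := hlen ▸ Nat.base_pow_length_digits_le 10 N (by norm_num) hN0
  have hk : n ≤ k := by
    by_contra! h
    rw [nStep_of_lt _ h, hdi k h] at hkm
    have h1 : N < 10 := hkm ▸ Nat.mod_lt _ (by norm_num)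
    have h2 : 10 ^ 2 ≤ 10 ^ n := Nat.pow_le_pow_right (by norm_num) hn
    omega
  have hval : ∑ i ∈ Finset.range n, d i * 10 ^ (n - 1 - i) = N := by
    refine Eq.trans ?_ ((sum_div_pow_mod_mul_pow N n).trans (Nat.mod_eq_of_lt hlt))
    rw [← Finset.sum_range_reflect (fun i ↦ N / 10 ^ i % 10 * 10 ^ i)]
    refine Finset.sum_congr rfl fun i hi ↦ ?_
    rw [hdi i (Finset.mem_range.1 hi)]
  refine ⟨fun i ↦ ⟨d i, by rw [hdi i i.isLt]; exact Nat.mod_lt _ (by norm_num)⟩, ?_, ?_⟩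
  · exact (Finset.sum_range fun i ↦ d i * 10 ^ (n - 1 - i)).symm.trans hval
  · rw [or_iff_not_imp_left]
    intro hs
    dsimp only at hs ⊢
    rw [← Finset.sum_range, not_lt] at hs
    have hs9 : ∑ i ∈ Finset.range n, d i ≤ 9 * n := by
      calc ∑ i ∈ Finset.range n, d i ≤ ∑ i ∈ Finset.range n, 9 :=
            Finset.sum_le_sum fun i hi ↦ by
              rw [hdi i (Finset.mem_range.1 hi)]
              omega
        _ = 9 * n := by simp [mul_comm]
    refine ⟨k, hk₀ k hk ?_ ?_, hk, ?_⟩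
    · calc n * nStep n (Pi.single 0 1) k
          ≤ (∑ i ∈ Finset.range n, d i) * nStep n (Pi.single 0 1) k := by gcongr
        _ ≤ nStep n d k := sum_mul_le_nStep d hk
        _ < 10 ^ n := hkm ▸ hlt
    · calc 10 ^ n ≤ 10 * nStep n d k := hkm ▸ hge
        _ ≤ 10 * ((∑ i ∈ Finset.range n, d i) * (2 * nStep n (Pi.single 0 1) k)) := by
            gcongr
            exact nStep_le_sum_mul d hn hk
        _ ≤ 10 * (9 * n * (2 * nStep n (Pi.single 0 1) k)) := by gcongr
        _ = 180 * n * nStep n (Pi.single 0 1) k := by ring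
    · simp only [keithWeight, sub_mul, Finset.sum_sub_distrib]
      rw [sub_eq_zero]
      have h := hval.trans (hkm.symm.trans (nStep_eq_sum_mul n d k))
      rw [Finset.sum_range, Finset.sum_range] at h
      simp only [mul_comm (d _)] at h
      exact_mod_cast h

lemma exists_finset_isKeith {n : ℕ} (hn : 2 ≤ n) : ∃ S : Finset ℕ,
    (∀ N, IsKeith N → (Nat.digits 10 N).length = n → N ∈ S) ∧
      (S.card : ℝ) ≤ 161 * (10 ^ n / √n) := by
  classical
  obtain ⟨k₀, hk₀⟩ := exists_window n (10 ^ n) hn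
  set A : Finset (Fin n → Fin 10) := {a | ∑ i, (a i : ℕ) < n} with hA
  set B : ℕ → Finset (Fin n → Fin 10) := fun k ↦
    {a | ∑ i, keithWeight n k i * (a i : ℕ) = 0} with hB
  set I : Finset ℕ := {k ∈ Finset.Ico k₀ (k₀ + 16) | n ≤ k} with hI
  refine ⟨(A ∪ I.biUnion B).image fun a ↦ ∑ i : Fin n, (a i : ℕ) * 10 ^ (n - 1 - (i : ℕ)), ?_, ?_⟩
  · intro N hN hlen
    obtain ⟨a, ha, h⟩ := exists_digits_of_isKeith hn hk₀ hN hlen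
    refine Finset.mem_image.2 ⟨a, ?_, ha⟩
    rcases h with h | ⟨k, hk, hnk, h⟩
    · exact Finset.mem_union_left _ (by simpa [hA] using h)
    · exact Finset.mem_union_right _ (Finset.mem_biUnion.2
        ⟨k, Finset.mem_filter.2 ⟨hk, hnk⟩, by simpa [hB] using h⟩)
  · have hIc : I.card ≤ 16 := (Finset.card_filter_le _ _).trans (by simp)
    have hcard : ((A ∪ I.biUnion B).image fun a ↦ ∑ i : Fin n, (a i : ℕ) * 10 ^ (n - 1 - (i : ℕ))).card
        ≤ 4 ^ n + 16 * (n.choose (n / 2) * 5 ^ n * 10) := by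
      refine Finset.card_image_le.trans ((Finset.card_union_le _ _).trans ?_)
      refine add_le_add (card_sum_digits_lt_le n) ?_
      refine (Finset.card_biUnion_le_card_mul I B _ fun k hk ↦
        card_keithWeight_le hn (Finset.mem_filter.1 hk).2).trans ?_
      gcongr
    have hn0 : (0 : ℝ) < n := by positivity
    have h4 : (4 : ℝ) ^ n ≤ 10 ^ n / √n := by
      have hsq : √(n : ℝ) ≤ 2 ^ n := by
        have h1 : (n : ℝ) ≤ 2 ^ n := by exact_mod_cast n.lt_two_pow_self.le
        have h2 : (1 : ℝ) ≤ 2 ^ n := one_le_pow₀ (by norm_num)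
        rw [Real.sqrt_le_left (by positivity)]
        nlinarith
      rw [le_div_iff₀ (by positivity)]
      calc (4 : ℝ) ^ n * √n ≤ 4 ^ n * 2 ^ n := by gcongr
        _ = 8 ^ n := by rw [← mul_pow]; norm_num
        _ ≤ 10 ^ n := by gcongr; norm_num
    have hch := choose_half_le (by omega : 0 < n)
    calc _ ≤ ((4 ^ n + 16 * (n.choose (n / 2) * 5 ^ n * 10) : ℕ) : ℝ) := by exact_mod_cast hcard
      _ = 4 ^ n + 160 * (n.choose (n / 2) * 5 ^ n) := by push_cast; ring
      _ ≤ 10 ^ n / √n + 160 * (2 ^ n / √n * 5 ^ n) := by gcongr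
      _ = 161 * (10 ^ n / √n) := by
          rw [div_mul_eq_mul_div, ← mul_pow]
          norm_num
          ring

lemma sum_pow_div_sqrt_le {L : ℕ} (hL : 1 ≤ L) :
    ∑ n ∈ Finset.Icc 1 L, (10 : ℝ) ^ n / √n ≤ 2 * (10 ^ L / √L) := by
  induction L, hL using Nat.le_induction with
  | base => norm_num
  | succ L hL ih =>
    rw [Finset.sum_Icc_succ_top (by omega)]
    have hL' : (1 : ℝ) ≤ L := by exact_mod_cast hL
    have h : √((L + 1 : ℕ) : ℝ) ≤ 5 * √L := by
      rw [Real.sqrt_le_left (by positivity), mul_pow, Real.sq_sqrt (by positivity)]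
      push_cast
      linarith
    have h2 : 2 * ((10 : ℝ) ^ L / √L) ≤ 10 ^ (L + 1) / √((L + 1 : ℕ) : ℝ) := by
      rw [← mul_div_assoc, div_le_div_iff₀ (by positivity) (by positivity), pow_succ]
      nlinarith [pow_pos (by norm_num : (0 : ℝ) < 10) L]
    linarith

/-- The number of Keith numbers in [1, x] is O(x/√(log x)). -/
theorem keith_count :
    ∃ C : ℝ, 0 < C ∧ ∀ x : ℕ, 2 ≤ x →
      ({N : ℕ | 1 ≤ N ∧ N ≤ x ∧ IsKeith N}.ncard : ℝ)
        ≤ C * x / Real.sqrt (Real.log x) := by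
  refine ⟨161 * 2 * 10 * 2, by norm_num, fun x hx ↦ ?_⟩
  have hex (n : ℕ) : ∃ S : Finset ℕ, 2 ≤ n →
      (∀ N, IsKeith N → (Nat.digits 10 N).length = n → N ∈ S) ∧
        (S.card : ℝ) ≤ 161 * (10 ^ n / √n) := by
    by_cases hn : 2 ≤ n
    · obtain ⟨S, hS⟩ := exists_finset_isKeith hn
      exact ⟨S, fun _ ↦ hS⟩
    · exact ⟨∅, fun h ↦ absurd h hn⟩
  choose S hS using hex
  set L := (Nat.digits 10 x).length with hL
  have hxL : x < 10 ^ L := Nat.lt_base_pow_length_digits (by norm_num)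
  have hLx : 10 ^ L ≤ 10 * x := Nat.base_pow_length_digits_le 10 x (by norm_num) (by omega)
  have hL1 : 1 ≤ L := by
    by_contra! h
    rw [Nat.lt_one_iff.1 h] at hxL
    omega
  have hsub : {N : ℕ | 1 ≤ N ∧ N ≤ x ∧ IsKeith N} ⊆ ↑((Finset.Icc 2 L).biUnion S) := by
    rintro N ⟨-, hNx, hN⟩
    exact Finset.mem_coe.2 (Finset.mem_biUnion.2 ⟨_, Finset.mem_Icc.2
      ⟨hN.1, Nat.le_length_digits_le 10 N x hNx⟩, (hS _ hN.1).1 N hN rfl⟩)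
  have hlogx : 0 < Real.log x := Real.log_pos (by exact_mod_cast hx)
  have hlog : Real.log x ≤ 2 ^ 2 * L := by
    have h10 : Real.log 10 ≤ 2 ^ 2 := by
      rw [Real.log_le_iff_le_exp (by norm_num)]
      calc (10 : ℝ) ≤ 2 ^ 4 := by norm_num
        _ ≤ Real.exp 1 ^ 4 := by
            gcongr
            linarith [Real.add_one_le_exp 1]
        _ = Real.exp (2 ^ 2) := by rw [← Real.exp_nat_mul]; norm_num
    calc Real.log x ≤ Real.log (10 ^ L) :=
          Real.log_le_log (by positivity) (by exact_mod_cast hxL.le)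
      _ = L * Real.log 10 := Real.log_pow _ _
      _ ≤ L * 2 ^ 2 := by gcongr
      _ = 2 ^ 2 * L := mul_comm _ _
  have hsqrt : √(Real.log x) ≤ 2 * √L := by
    refine (Real.sqrt_le_sqrt hlog).trans_eq ?_
    rw [Real.sqrt_mul (by positivity), Real.sqrt_sq (by norm_num)]
  calc ({N : ℕ | 1 ≤ N ∧ N ≤ x ∧ IsKeith N}.ncard : ℝ)
      ≤ ((Finset.Icc 2 L).biUnion S).card := by
        exact_mod_cast (Set.ncard_le_ncard hsub (Finset.finite_toSet _)).trans_eq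
          (Set.ncard_coe_finset _)
    _ ≤ ∑ n ∈ Finset.Icc 2 L, ((S n).card : ℝ) := by exact_mod_cast Finset.card_biUnion_le
    _ ≤ ∑ n ∈ Finset.Icc 2 L, 161 * (10 ^ n / √n) :=
        Finset.sum_le_sum fun n hn ↦ (hS n (Finset.mem_Icc.1 hn).1).2
    _ ≤ ∑ n ∈ Finset.Icc 1 L, 161 * (10 ^ n / √n) :=
        Finset.sum_le_sum_of_subset_of_nonneg (Finset.Icc_subset_Icc_left (by norm_num))
          fun _ _ _ ↦ by positivity
    _ ≤ 161 * (2 * (10 ^ L / √L)) := by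
        rw [← Finset.mul_sum]
        gcongr
        exact sum_pow_div_sqrt_le hL1
    _ ≤ 161 * (2 * (10 * x / √L)) := by
        gcongr
        exact_mod_cast hLx
    _ = 161 * 2 * 10 * 2 * x / (2 * √L) := by
        have : 0 < √(L : ℝ) := by positivity
        field_simp
    _ ≤ 161 * 2 * 10 * 2 * x / √(Real.log x) := by gcongr
end

section
/- Let N be a string of digits a_1,...,a_n (each in {0,...,9}, n ≥ 1) having at least k ≥ 1 nonzero entries. Then K^N_m ≥ L^k_{k+m−n} holds for every m ≥ n + 1. -/
theorem keithList_eq_take (a : List ℕ) (m : ℕ) (hm : m ≤ a.length) :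
    keithList a m = a.take m := by
  induction m with
  | zero => simp [keithList]
  | succ m ih =>
    have hlt : m < a.length := hm
    simp only [keithList, ih hlt.le, hlt, if_true]
    rw [List.take_succ_eq_append_getElem hlt, List.getD_eq_getElem _ _ hlt]

theorem keithList_length_add_succ (a : List ℕ) (j : ℕ) :
    keithList a (a.length + (j + 1)) =
      keithList a (a.length + j) ++ [((keithList a (a.length + j)).drop j).sum] := by
  rw [← Nat.add_assoc]
  simp [keithList]

theorem length_filter_ne_zero_le_sum (a : List ℕ) :
    (a.filter (· ≠ 0)).length ≤ a.sum := by
  induction a with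
  | nil => simp
  | cons x l ih =>
    by_cases hx : x = 0
    · simpa [hx] using ih
    · have hfilter : (x :: l).filter (· ≠ 0) = x :: l.filter (· ≠ 0) := by simp [hx]
      rw [hfilter, List.length_cons, List.sum_cons]
      omega

theorem length_filter_ne_zero_sub_le_sum_drop (a : List ℕ) (j : ℕ) :
    (a.filter (· ≠ 0)).length - j ≤ (a.drop j).sum := by
  have hsplit : (a.filter (· ≠ 0)).length =
      ((a.take j).filter (· ≠ 0)).length + ((a.drop j).filter (· ≠ 0)).length := by
    rw [← List.length_append, ← List.filter_append, List.take_append_drop]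
  have htake := List.length_filter_le (· ≠ 0) (a.take j)
  have hlen := List.length_take_le j a
  have hdrop := length_filter_ne_zero_le_sum (a.drop j)
  omega

/-- Beyond the initial strings, the Keith sequence of `a` dominates that of `k` ones. -/
theorem exists_keithList_tails (a : List ℕ) (k : ℕ)
    (hcount : k ≤ (a.filter (· ≠ 0)).length) (j : ℕ) :
    ∃ T U : List ℕ, keithList a (a.length + j) = a ++ T ∧
      keithList (List.replicate k 1) (k + j) = List.replicate k 1 ++ U ∧
      List.Forall₂ (· ≤ ·) U T ∧ U.length = j := by
  induction j with
  | zero =>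
    refine ⟨[], [], ?_, ?_, .nil, rfl⟩
    · simp [keithList_eq_take]
    · simp [keithList_eq_take]
  | succ j ih =>
    obtain ⟨T, U, hT, hU, hle, hlen⟩ := ih
    have hstep := keithList_length_add_succ (List.replicate k 1) j
    rw [List.length_replicate, hU] at hstep
    refine ⟨T ++ [((a ++ T).drop j).sum], U ++ [((List.replicate k 1 ++ U).drop j).sum],
      ?_, ?_, ?_, ?_⟩
    · rw [keithList_length_add_succ, hT, List.append_assoc]
    · rw [hstep, List.append_assoc]
    · refine List.rel_append hle (.cons ?_ .nil)
      have hka : k ≤ a.length := hcount.trans (List.length_filter_le _ _)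
      have hinit : k - j ≤ (a.drop j).sum :=
        (Nat.sub_le_sub_right hcount j).trans (length_filter_ne_zero_sub_le_sum_drop a j)
      have hdrop : (U.drop (j - k)).sum ≤ (T.drop (j - k)).sum :=
        (List.forall₂_drop (j - k) hle).sum_le_sum
      have hmore : (T.drop (j - k)).sum ≤ (T.drop (j - a.length)).sum :=
        (List.drop_sublist_drop_left T (by omega)).sum_le_sum (by simp)
      simp only [List.drop_append, List.sum_append, List.drop_replicate,
        List.sum_replicate, List.length_replicate, smul_eq_mul, mul_one]
      omega
    · simp [hlen]

/-- If the digit string a (length n ≥ 1, digits ≤ 9) has at least k ≥ 1 nonzero entries,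
then K^N_m ≥ L^k_{k+m−n} for every m ≥ n + 1, where L^k is the Keith sequence of the
string of k ones. -/
theorem keith_ge_L_of_nonzero_count (a : List ℕ) (k : ℕ)
    (hn : 1 ≤ a.length) (hd : ∀ d ∈ a, d ≤ 9)
    (hk : 1 ≤ k) (hcount : k ≤ (a.filter (· ≠ 0)).length) :
    ∀ m, a.length + 1 ≤ m →
      keithSeq (List.replicate k 1) (k + m - a.length) ≤ keithSeq a m := by
  intro m hm
  obtain ⟨j, rfl⟩ : ∃ j, m = a.length + (j + 1) := ⟨m - a.length - 1, by omega⟩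
  obtain ⟨T, U, hT, hU, hle, hlen⟩ := exists_keithList_tails a k hcount (j + 1)
  have hlenT : T.length = j + 1 := hle.length_eq ▸ hlen
  have hidx : k + (a.length + (j + 1)) - a.length = k + (j + 1) := by omega
  rw [hidx, keithSeq, keithSeq, hT, hU]
  have hk' : k + (j + 1) - 1 = k + j := by omega
  have hn' : a.length + (j + 1) - 1 = a.length + j := by omega
  rw [hk', hn', List.getD_append_right _ _ _ _ (by simp),
    List.getD_append_right _ _ _ _ (by simp), List.length_replicate,
    Nat.add_sub_cancel_left, Nat.add_sub_cancel_left,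
    List.getD_eq_getElem _ _ (by omega), List.getD_eq_getElem _ _ (by omega)]
  exact hle.get (by omega) (by omega)
end

section
/- Let N be a positive integer with n ≥ 3 decimal digits. If N = K^N_m for some index m ≥ 1 (i.e., N is a Keith number), then 2n < m < 7n. -/
theorem keithList_eq_map_range (a : List ℕ) (m : ℕ) :
    keithList a m = (List.range m).map fun i => keithSeq a (i + 1) := by
  induction m with
  | zero => rfl
  | succ m ih =>
    have hlen : (keithList a m).length = m := by rw [ih]; simp
    rw [List.range_succ, List.map_append, ← ih]
    simp [keithSeq, keithList, hlen]

theorem sum_drop_map_range (f : ℕ → ℕ) (k m : ℕ) :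
    (((List.range m).map f).drop k).sum = ∑ i ∈ Finset.Ico k m, f i := by
  induction m with
  | zero => simp
  | succ m ih =>
    rcases le_or_gt k m with h | h
    · rw [List.range_succ, List.map_append, List.drop_append_of_le_length (by simpa using h),
        List.sum_append, ih, Finset.sum_Ico_succ_top h]
      simp
    · rw [List.drop_eq_nil_of_le (by simpa using h), Finset.Ico_eq_empty (by omega)]
      simp

theorem keithSeq_succ_s5 (a : List ℕ) (m : ℕ) :
    keithSeq a (m + 1) = if m < a.length then a.getD m 0 else
      ∑ i ∈ Finset.Ico (m - a.length) m, keithSeq a (i + 1) := by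
  have hlen : (keithList a m).length = m := by rw [keithList_eq_map_range]; simp
  rw [← sum_drop_map_range, ← keithList_eq_map_range]
  simp [keithSeq, keithList, hlen]

theorem keithSeq_succ_of_lt {a : List ℕ} {m : ℕ} (h : m < a.length) :
    keithSeq a (m + 1) = a.getD m 0 := by
  rw [keithSeq_succ_s5, if_pos h]

theorem keithSeq_succ_of_le {a : List ℕ} {m : ℕ} (h : a.length ≤ m) :
    keithSeq a (m + 1) = ∑ i ∈ Finset.Ico (m - a.length) m, keithSeq a (i + 1) := by
  rw [keithSeq_succ_s5, if_neg (by omega)]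

theorem keithSeq_le_two_pow_mul {a : List ℕ} {b : ℕ} (hb : ∀ x ∈ a, x ≤ b) (j : ℕ) :
    keithSeq a (a.length + j + 1) ≤ 2 ^ j * (a.length * b) := by
  induction j with
  | zero =>
    rw [keithSeq_succ_of_le (by omega)]
    refine (Finset.sum_le_card_nsmul _ _ b fun i hi => ?_).trans (by simp)
    have hi' : i < a.length := by simpa using hi
    rw [keithSeq_succ_of_lt hi', List.getD_eq_getElem _ _ hi']
    exact hb _ (List.getElem_mem hi')
  | succ j ih =>
    have hsub : ∑ i ∈ Finset.Ico (a.length + (j + 1) - a.length) (a.length + j),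
        keithSeq a (i + 1) ≤ keithSeq a (a.length + j + 1) := by
      rw [keithSeq_succ_of_le (m := a.length + j) (by omega)]
      exact Finset.sum_le_sum_of_subset (Finset.Ico_subset_Ico_left (by omega))
    rcases Nat.eq_zero_or_pos a.length with h0 | h0
    · rw [keithSeq_succ_of_le (by omega), Finset.Ico_eq_empty (by omega)]
      simp
    · rw [keithSeq_succ_of_le (by omega), ← add_assoc a.length j 1,
        Finset.sum_Ico_succ_top (by omega), pow_succ]
      rw [← add_assoc a.length j 1] at hsub
      linarith

theorem fib_le_keithSeq {a : List ℕ} (h2 : 2 ≤ a.length) (ha : 0 < a.getD 0 0) (j : ℕ) :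
    Nat.fib j ≤ keithSeq a (a.length + j) := by
  have hmem : ∀ {m i : ℕ}, a.length ≤ m → i < m → m ≤ i + a.length →
      keithSeq a (i + 1) ≤ keithSeq a (m + 1) := by
    intro m i hm hi hi'
    rw [keithSeq_succ_of_le hm]
    exact Finset.single_le_sum (f := fun i => keithSeq a (i + 1)) (fun _ _ => Nat.zero_le _)
      (Finset.mem_Ico.2 ⟨by omega, hi⟩)
  have h1 : 0 < keithSeq a (a.length + 1) := by
    have := hmem (m := a.length) (i := 0) le_rfl (by omega) (by omega)
    rw [keithSeq_succ_of_lt (by omega)] at this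
    omega
  induction j using Nat.twoStepInduction with
  | zero => simp
  | one => exact h1
  | more j ih ih' =>
    obtain ⟨k, hk⟩ : ∃ k, a.length + j = k + 1 := ⟨a.length + j - 1, by omega⟩
    rw [Nat.fib_add_two, show a.length + (j + 2) = k + 2 + 1 by omega]
    rw [show a.length + (j + 1) = k + 1 + 1 by omega] at ih'
    rw [hk] at ih
    rw [keithSeq_succ_of_le (by omega), Finset.sum_Ico_succ_top (by omega),
      Finset.sum_Ico_succ_top (by omega)]
    omega

theorem ten_pow_le_fib {n : ℕ} (hn : 2 ≤ n) : 10 ^ n ≤ Nat.fib (6 * n) := by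
  induction n, hn using Nat.le_induction with
  | base => decide
  | succ n _ ih =>
    have h : Nat.fib (6 * n + 5 + 1) = Nat.fib (6 * n) * 5 + Nat.fib (6 * n + 1) * 8 :=
      Nat.fib_add (6 * n) 5
    have := Nat.fib_le_fib_succ (n := 6 * n)
    rw [show 6 * (n + 1) = 6 * n + 5 + 1 by ring, h, pow_succ]
    omega

theorem two_pow_mul_lt_ten_pow {k : ℕ} (hk : 3 ≤ k) : 2 ^ k * ((k + 1) * 9) < 10 ^ k := by
  induction k, hk using Nat.le_induction with
  | base => norm_num
  | succ k _ ih =>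
    rw [pow_succ, pow_succ]
    nlinarith [Nat.two_pow_pos k]

theorem keithSeq_ne_of_length_eq_three {N m : ℕ} (hN : (Nat.digits 10 N).length = 3)
    (hm : 1 ≤ m) (hm' : m ≤ 6) : keithSeq (Nat.digits 10 N).reverse m ≠ N := by
  have hval := Nat.ofDigits_digits 10 N
  have hlt : ∀ d ∈ Nat.digits 10 N, d < 10 := fun d hd => Nat.digits_lt_base (by norm_num) hd
  have hlow : 10 ^ 2 ≤ N := (Nat.lt_digits_length_iff (by norm_num) N).1 (by omega)
  obtain ⟨c, b, a, hd⟩ := List.length_eq_three.1 hN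
  rw [hd] at hval hlt ⊢
  simp [Nat.ofDigits] at hval hlt
  interval_cases m <;> simp [keithSeq, keithList] <;> omega

/-- If N has n ≥ 3 decimal digits and N = K^N_m for some m ≥ 1, then 2n < m < 7n. -/
theorem keith_index_bounds (N n m : ℕ)
    (hn : (Nat.digits 10 N).length = n) (h3 : 3 ≤ n)
    (hm : 1 ≤ m) (hK : keithSeq ((Nat.digits 10 N).reverse) m = N) :
    2 * n < m ∧ m < 7 * n := by
  have hlow : 10 ^ (n - 1) ≤ N := (Nat.lt_digits_length_iff (by norm_num) N).1 (by omega)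
  have hupp : N < 10 ^ n := (Nat.digits_length_le_iff (by norm_num) N).1 hn.le
  have hlen : (Nat.digits 10 N).reverse.length = n := by simpa using hn
  have hdig : ∀ x ∈ (Nat.digits 10 N).reverse, x ≤ 9 := fun x hx =>
    Nat.le_of_lt_succ (Nat.digits_lt_base (by norm_num) (List.mem_reverse.1 hx))
  constructor
  · by_contra! hle
    rcases h3.eq_or_lt with rfl | h4
    · exact keithSeq_ne_of_length_eq_three hn hm hle hK
    have hpow := two_pow_mul_lt_ten_pow (k := n - 1) (by omega)
    rw [Nat.sub_add_cancel (by omega)] at hpow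
    rcases le_or_gt m n with hmn | hmn
    · obtain ⟨k, rfl⟩ := Nat.exists_eq_add_of_le' hm
      have hk : k < (Nat.digits 10 N).reverse.length := by omega
      rw [keithSeq_succ_of_lt hk, List.getD_eq_getElem _ _ hk] at hK
      have h9 := hdig _ (List.getElem_mem hk)
      have : 10 ^ 1 ≤ 10 ^ (n - 1) := Nat.pow_le_pow_right (by norm_num) (by omega)
      omega
    · obtain ⟨j, rfl⟩ := Nat.exists_eq_add_of_le (Nat.succ_le_of_lt hmn)
      have hj := keithSeq_le_two_pow_mul hdig j
      rw [hlen, show n + j + 1 = n.succ + j by omega, hK] at hj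
      have : 2 ^ j ≤ 2 ^ (n - 1) := Nat.pow_le_pow_right (by norm_num) (by omega)
      have := Nat.mul_le_mul_right (n * 9) this
      omega
  · by_contra! hle
    obtain ⟨j, rfl⟩ := Nat.exists_eq_add_of_le (show n ≤ m by omega)
    have hne : Nat.digits 10 N ≠ [] := List.ne_nil_of_length_pos (by omega)
    have hlead : 0 < (Nat.digits 10 N).reverse.getD 0 0 := by
      have := Nat.getLast_digit_ne_zero 10 (m := N) (by rintro rfl; simp at hne)
      rw [List.getD_eq_getElem _ _ (by omega), List.getElem_zero, List.head_reverse]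
      exact Nat.pos_of_ne_zero this
    have hfib := fib_le_keithSeq (by omega) hlead j
    rw [hlen, hK] at hfib
    have := ten_pow_le_fib (n := n) (by omega)
    have := Nat.fib_mono (show 6 * n ≤ j by omega)
    omega
end

section
/- For every n ≥ 1 and every j with 1 ≤ j ≤ n + 1, one has L^n_{n+j} = 2^{j−1}·(n − 1) + 1. -/
theorem keithList_succ_s7 (a : List ℕ) (m : ℕ) :
    keithList a (m + 1) = keithList a m ++
      [if m < a.length then a.getD m 0 else ((keithList a m).drop (m - a.length)).sum] :=
  rfl

theorem keithList_replicate_of_le {n m : ℕ} (h : m ≤ n) :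
    keithList (List.replicate n 1) m = List.replicate m 1 := by
  induction m with
  | zero => rfl
  | succ m ih =>
    have hm : m < n := h
    rw [keithList_succ_s7, ih hm.le, List.replicate_succ']
    simp [hm]

theorem sum_map_range_two_pow_mul_add_one (c j : ℕ) :
    ((List.range j).map fun i => 2 ^ i * c + 1).sum + c = 2 ^ j * c + j := by
  induction j with
  | zero => simp
  | succ j ih =>
    simp only [List.range_succ, List.map_append, List.sum_append, List.map_cons, List.map_nil,
      List.sum_cons, List.sum_nil, pow_succ]
    linarith

theorem keithList_replicate_add {n j : ℕ} (hn : 1 ≤ n) (hj : j ≤ n + 1) :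
    keithList (List.replicate n 1) (n + j) =
      List.replicate n 1 ++ (List.range j).map fun i => 2 ^ i * (n - 1) + 1 := by
  induction j with
  | zero => simp [keithList_replicate_of_le le_rfl]
  | succ j ih =>
    have hsum := sum_map_range_two_pow_mul_add_one (n - 1) j
    rw [← Nat.add_assoc, keithList_succ_s7, ih (by omega), List.length_replicate,
      if_neg (by omega), Nat.add_sub_cancel_left,
      List.drop_append_of_le_length (by rw [List.length_replicate]; omega),
      List.drop_replicate, List.sum_append, List.sum_replicate, smul_eq_mul, mul_one,
      List.range_succ, List.map_append, List.append_assoc]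
    simp only [List.map_cons, List.map_nil]
    congr 3
    omega

/-- For every n ≥ 1 and 1 ≤ j ≤ n + 1, L^n_{n+j} = 2^{j−1}·(n−1) + 1. -/
theorem L_initial_values (n j : ℕ) (hn : 1 ≤ n) (hj1 : 1 ≤ j) (hj2 : j ≤ n + 1) :
    keithSeq (List.replicate n 1) (n + j) = 2 ^ (j - 1) * (n - 1) + 1 := by
  obtain ⟨k, rfl⟩ := Nat.exists_eq_add_of_le' hj1
  rw [keithSeq, keithList_replicate_add hn hj2, List.getD_append_right _ _ _ _ (by simp)]
  simp
end

section
/- Let k ≥ 2 and n ≥ 1 be integers, and let X ⊆ {1,2,...,k}^n be an antichain with respect to the product order. Then |X| < (k/2)·k^n / n^{1/2}. -/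
open scoped symmDiff in
/-- An antichain in a finite power of a finite chain, bounded by averaging Sperner's theorem over
the Boolean cubes `∏ i, {c i, σ (c i)}` for a fixed-point-free permutation `σ` of the chain. -/
theorem two_pow_mul_card_antichain_le {ι α : Type*} [Fintype ι] [DecidableEq ι]
    [LinearOrder α] [Fintype α] (σ : Equiv.Perm α) (hσ : ∀ a, σ a ≠ a)
    (X : Finset (ι → α)) (hX : IsAntichain (· ≤ ·) (X : Set (ι → α))) :
    2 ^ Fintype.card ι * X.card ≤
      Fintype.card α ^ Fintype.card ι *
        (Fintype.card ι).choose (Fintype.card ι / 2) := by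
  let φ : Finset ι → (ι → α) → ι → α := fun T c i => if i ∈ T then σ (c i) else c i
  have hbij (T : Finset ι) : (Finset.univ.filter fun c => φ T c ∈ X).card = X.card := by
    let e : (ι → α) ≃ (ι → α) :=
      Equiv.piCongrRight fun i => if i ∈ T then σ else Equiv.refl α
    have he (c : ι → α) : φ T c = e c := by
      funext i
      by_cases hi : i ∈ T <;> simp [φ, e, hi]
    refine Finset.card_bij (fun c _ => e c) ?_ ?_ ?_
    · intro c hc
      simpa [he] using hc
    · intro a _ b _ hab
      exact e.injective hab
    · intro x hx
      exact ⟨e.symm x, by simpa [he] using hx, by simp⟩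
  have hcube (c : ι → α) : (Finset.univ.filter fun T => φ T c ∈ X).card ≤
      (Fintype.card ι).choose (Fintype.card ι / 2) := by
    let D : Finset ι := Finset.univ.filter fun i => σ (c i) < c i
    have hinj : Function.Injective fun T : Finset ι => T ∆ D := symmDiff_left_injective D
    rw [← Finset.card_image_of_injective _ hinj]
    apply IsAntichain.sperner
    intro A hA B hB hne hAB
    simp only [Finset.coe_image, Set.mem_image, Finset.mem_coe, Finset.mem_filter,
      Finset.mem_univ, true_and] at hA hB
    obtain ⟨S, hS, rfl⟩ := hA
    obtain ⟨T, hT, rfl⟩ := hB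
    have hle : φ S c ≤ φ T c := by
      intro i
      have h := @hAB i
      simp only [Finset.mem_symmDiff, D, Finset.mem_filter, Finset.mem_univ, true_and] at h
      by_cases h1 : i ∈ S <;> by_cases h2 : i ∈ T <;> simp only [φ, h1, h2, if_true, if_false]
      · exact le_rfl
      · by_contra! hlt
        simp [h1, h2, hlt.not_gt] at h
      · by_contra! hlt
        simp [h1, h2, hlt] at h
      · exact le_rfl
    have heq : φ S c = φ T c := hX.eq hS hT hle
    apply hne
    congr 1
    ext i
    have h := congrFun heq i
    by_cases h1 : i ∈ S <;> by_cases h2 : i ∈ T <;> simp [φ, h1, h2] at h ⊢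
    · exact hσ _ h
    · exact hσ _ h.symm
  calc 2 ^ Fintype.card ι * X.card
      = ∑ T : Finset ι, (Finset.univ.filter fun c => φ T c ∈ X).card := by
        simp [hbij]
    _ = ∑ c : ι → α, (Finset.univ.filter fun T => φ T c ∈ X).card := by
        simp only [Finset.card_filter]
        exact Finset.sum_comm
    _ ≤ ∑ _c : ι → α, (Fintype.card ι).choose (Fintype.card ι / 2) :=
        Finset.sum_le_sum fun c _ => hcube c
    _ = _ := by simp

theorem Nat.two_mul_add_one_mul_centralBinom_sq_le (m : ℕ) :
    (2 * m + 1) * m.centralBinom ^ 2 ≤ 16 ^ m := by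
  induction m with
  | zero => simp
  | succ m ih =>
    have h := Nat.succ_mul_centralBinom_succ m
    have hpos : 0 < (m + 1) ^ 2 := by positivity
    refine Nat.le_of_mul_le_mul_left ?_ hpos
    calc (m + 1) ^ 2 * ((2 * (m + 1) + 1) * (m + 1).centralBinom ^ 2)
        = (2 * m + 3) * ((m + 1) * (m + 1).centralBinom) ^ 2 := by ring
      _ = 4 * ((2 * m + 3) * (2 * m + 1)) * ((2 * m + 1) * m.centralBinom ^ 2) := by
        rw [h]; ring
      _ ≤ 4 * (4 * (m + 1) ^ 2) * 16 ^ m :=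
        Nat.mul_le_mul (Nat.mul_le_mul_left 4 (by nlinarith)) ih
      _ = (m + 1) ^ 2 * 16 ^ (m + 1) := by ring

theorem Nat.mul_choose_half_sq_lt (n : ℕ) : n * n.choose (n / 2) ^ 2 < 4 ^ n := by
  obtain ⟨m, rfl | rfl⟩ := Nat.even_or_odd' n
  · have h := Nat.two_mul_add_one_mul_centralBinom_sq_le m
    have hpos := pow_pos m.centralBinom_pos 2
    rw [Nat.mul_div_cancel_left m two_pos, ← Nat.centralBinom_eq_two_mul_choose, pow_mul]
    norm_num
    nlinarith
  · have h := Nat.two_mul_add_one_mul_centralBinom_sq_le (m + 1)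
    have hc : (m + 1).centralBinom = 2 * (2 * m + 1).choose m := by
      rw [Nat.centralBinom_eq_two_mul_choose, show 2 * (m + 1) = 2 * m + 1 + 1 by ring,
        Nat.choose_succ_succ, Nat.choose_symm_half]
      ring
    have hpos : 0 < (2 * m + 1).choose m ^ 2 := pow_pos (Nat.choose_pos (by omega)) 2
    rw [hc] at h
    rw [show (2 * m + 1) / 2 = m by omega, pow_succ 4, pow_mul]
    rw [pow_succ 16] at h
    norm_num at h ⊢
    nlinarith

/-- Any antichain X in P(k,n) = {1,…,k}^n with the product (componentwise) order
satisfies |X| < (k/2)·k^n/√n, for k ≥ 2 and n ≥ 1. -/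
theorem antichain_bound (k n : ℕ) (hk : 2 ≤ k) (hn : 1 ≤ n)
    (X : Finset (Fin n → ℕ))
    (hmem : ∀ x ∈ X, ∀ i, 1 ≤ x i ∧ x i ≤ k)
    (hanti : IsAntichain (· ≤ ·) (X : Set (Fin n → ℕ))) :
    (X.card : ℝ) < ((k : ℝ) / 2) * (k : ℝ) ^ n / Real.sqrt n := by
  let f : (Fin n → Fin k) → Fin n → ℕ := fun y i => (y i : ℕ) + 1
  have hf : Function.Injective f := by
    intro a b hab
    funext i
    have h := congrFun hab i
    exact Fin.ext (Nat.succ_injective h)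
  let Y : Finset (Fin n → Fin k) := Finset.univ.filter fun y => f y ∈ X
  have hY : IsAntichain (· ≤ ·) (Y : Set (Fin n → Fin k)) := by
    intro a ha b hb hne hab
    simp only [Y, Finset.coe_filter, Finset.mem_univ, true_and, Set.mem_ofPred_eq] at ha hb
    exact hanti ha hb (hf.ne hne) fun i => Nat.succ_le_succ (hab i)
  have hcard : X.card = Y.card := by
    symm
    refine Finset.card_bij (fun y _ => f y) (fun y hy => (Finset.mem_filter.1 hy).2)
      (fun a _ b _ hab => hf hab) fun x hx => ?_
    have hfx : f (fun i => ⟨x i - 1, by have := hmem x hx i; omega⟩) = x := by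
      funext i
      have := hmem x hx i
      simp only [f]
      omega
    exact ⟨_, by simpa [Y, hfx] using hx, hfx⟩
  have hrot (a : Fin k) : finRotate k a ≠ a := by
    have h := (support_finRotate_of_le hk).symm ▸ Finset.mem_univ a
    exact Equiv.Perm.mem_support.1 h
  have hmain := two_pow_mul_card_antichain_le (finRotate k) hrot Y hY
  rw [← hcard] at hmain
  simp only [Fintype.card_fin] at hmain
  have hchoose := Nat.mul_choose_half_sq_lt n
  set C := n.choose (n / 2)
  have hsqrt : Real.sqrt n * C < 2 ^ n := by
    refine lt_of_pow_lt_pow_left₀ 2 (by positivity) ?_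
    rw [mul_pow, Real.sq_sqrt (Nat.cast_nonneg n), ← pow_mul, mul_comm n 2, pow_mul]
    norm_num
    exact_mod_cast hchoose
  have hmainR : (2 : ℝ) ^ n * X.card ≤ (k : ℝ) ^ n * C := by exact_mod_cast hmain
  have hkR : (2 : ℝ) ≤ k := by exact_mod_cast hk
  have hkn : (0 : ℝ) < (k : ℝ) ^ n := by positivity
  have hs : 0 < Real.sqrt n := Real.sqrt_pos.2 (by exact_mod_cast hn)
  rw [lt_div_iff₀ hs]
  have hlt : (X.card : ℝ) * Real.sqrt n < (k : ℝ) ^ n := by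
    refine lt_of_mul_lt_mul_left ?_ (by positivity : (0 : ℝ) ≤ 2 ^ n)
    calc (2 : ℝ) ^ n * (X.card * Real.sqrt n) = 2 ^ n * X.card * Real.sqrt n := by ring
      _ ≤ (k : ℝ) ^ n * C * Real.sqrt n := by gcongr
      _ = (k : ℝ) ^ n * (Real.sqrt n * C) := by ring
      _ < (k : ℝ) ^ n * 2 ^ n := by gcongr
      _ = 2 ^ n * (k : ℝ) ^ n := by ring
  nlinarith
end

section
/- There is a constant c > 0 such that for every positive integer n divisible by 3, the poset P(3, n) = {1,2,3}^n with the product order contains an antichain of size at least c·3^n/√n. One such antichain, for n = 3m, is the set X of all tuples having, for some i with 1 ≤ i ≤ m, exactly i coordinates equal to 1, exactly i coordinates equal to 3, and the remaining n − 2i coordinates equal to 2. -/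
open Finset in
/-- The number of vectors in `{1,2,3}^n` with exactly `i` ones and `i` threes, for all
`i` in `s`, is bounded below by the sum of the corresponding trinomial coefficients. -/
theorem sum_choose_mul_choose_le_ncard (m n : ℕ) (s : Finset ℕ)
    (hs : ∀ i ∈ s, 1 ≤ i ∧ i ≤ m) :
    ∑ i ∈ s, n.choose i * (n - i).choose i ≤
      {x : Fin n → ℕ | (∀ j, 1 ≤ x j ∧ x j ≤ 3) ∧
          ∃ i, 1 ≤ i ∧ i ≤ m ∧
            (Finset.univ.filter (fun j => x j = 1)).card = i ∧
            (Finset.univ.filter (fun j => x j = 3)).card = i}.ncard := by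
  set X := {x : Fin n → ℕ | (∀ j, 1 ≤ x j ∧ x j ≤ 3) ∧
          ∃ i, 1 ≤ i ∧ i ≤ m ∧
            (Finset.univ.filter (fun j => x j = 1)).card = i ∧
            (Finset.univ.filter (fun j => x j = 3)).card = i} with hX
  have hfin : X.Finite := by
    refine (Set.finite_Icc (fun _ : Fin n => 1) (fun _ => 3)).subset ?_
    intro x hx
    exact ⟨fun j => (hx.1 j).1, fun j => (hx.1 j).2⟩
  let S : Finset (Σ _ : ℕ, Σ _ : Finset (Fin n), Finset (Fin n)) :=
    s.sigma fun i => (powersetCard i univ).sigma fun A => powersetCard i Aᶜ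
  have hS : S.card = ∑ i ∈ s, n.choose i * (n - i).choose i := by
    simp only [S, card_sigma, card_powersetCard]
    refine sum_congr rfl fun i _ => ?_
    rw [sum_congr rfl (g := fun _ => (n - i).choose i)]
    · simp
    · intro A hA
      rw [card_compl, (mem_powersetCard.1 hA).2, Fintype.card_fin]
  let f : (Σ _ : ℕ, Σ _ : Finset (Fin n), Finset (Fin n)) → Fin n → ℕ :=
    fun p j => if j ∈ p.2.1 then 1 else if j ∈ p.2.2 then 3 else 2
  have hone : ∀ p, univ.filter (fun j => f p j = 1) = p.2.1 := by
    intro p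
    ext j
    simp only [f, mem_filter, mem_univ, true_and]
    split_ifs <;> simp_all
  have hthree : ∀ p ∈ S, univ.filter (fun j => f p j = 3) = p.2.2 := by
    intro p hp
    ext j
    have hsub : p.2.2 ⊆ p.2.1ᶜ := by
      simp only [S, mem_sigma, mem_powersetCard] at hp
      exact hp.2.2.1
    have hj := @hsub j
    simp only [mem_compl] at hj
    simp only [f, mem_filter, mem_univ, true_and]
    split_ifs <;> simp_all
  rw [← hS, Set.ncard_eq_toFinset_card X hfin]
  refine card_le_card_of_injOn f ?_ ?_
  · intro p hp
    have hp' := hp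
    simp only [S, coe_sigma, Set.mem_sigma_iff, mem_coe, mem_powersetCard] at hp'
    simp only [Set.Finite.coe_toFinset, hX, Set.mem_ofPred_eq]
    refine ⟨fun j => ?_, p.1, (hs _ hp'.1).1, (hs _ hp'.1).2, ?_, ?_⟩
    · simp only [f]
      split_ifs <;> simp
    · rw [hone, hp'.2.1.2]
    · rw [hthree p hp, hp'.2.2.2]
  · intro p hp q hq hpq
    have h1 : p.2.1 = q.2.1 := by rw [← hone p, ← hone q, hpq]
    have h3 : p.2.2 = q.2.2 := by rw [← hthree p hp, ← hthree q hq, hpq]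
    simp only [S, coe_sigma, Set.mem_sigma_iff, mem_coe, mem_powersetCard] at hp hq
    have h0 : p.1 = q.1 := by rw [← hp.2.1.2, ← hq.2.1.2, h1]
    obtain ⟨i, A, B⟩ := p
    obtain ⟨i', A', B'⟩ := q
    simp only at h0 h1 h3
    subst h0 h1 h3
    rfl

theorem choose_mul_choose_mul_factorial (i k : ℕ) :
    (2 * i + k).choose i * (2 * i + k - i).choose i * (i.factorial * i.factorial * k.factorial) =
      (2 * i + k).factorial := by
  have h1 := Nat.choose_mul_factorial_mul_factorial (n := 2 * i + k) (k := i) (by omega)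
  have h2 := Nat.choose_mul_factorial_mul_factorial (n := 2 * i + k - i) (k := i) (by omega)
  have h3 : 2 * i + k - i - i = k := by omega
  rw [h3] at h2
  rw [← h1, ← h2]
  ring

theorem two_mul_pow_mul_factorial_le (m : ℕ) (hm : 1 ≤ m) :
    2 * 27 ^ m * m.factorial ^ 3 ≤ 9 * m * (3 * m).factorial := by
  induction m, hm using Nat.le_induction with
  | base => decide
  | succ m hm ih =>
    have h : (3 * (m + 1)).factorial =
        (3 * m + 3) * ((3 * m + 2) * ((3 * m + 1) * (3 * m).factorial)) := by
      rw [show 3 * (m + 1) = 3 * m + 2 + 1 by ring, Nat.factorial_succ, Nat.factorial_succ,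
        Nat.factorial_succ]
    rw [h, Nat.factorial_succ]
    calc 2 * 27 ^ (m + 1) * ((m + 1) * m.factorial) ^ 3
        = 27 * (m + 1) ^ 3 * (2 * 27 ^ m * m.factorial ^ 3) := by ring
      _ ≤ 27 * (m + 1) ^ 3 * (9 * m * (3 * m).factorial) := by gcongr
      _ = (27 * (m + 1) ^ 2 * m) * (9 * (m + 1) * (3 * m).factorial) := by ring
      _ ≤ ((3 * m + 3) * (3 * m + 2) * (3 * m + 1)) * (9 * (m + 1) * (3 * m).factorial) := by
          refine Nat.mul_le_mul_right _ ?_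
          nlinarith [sq_nonneg m]
      _ = _ := by ring

theorem factorial_pow_three_mul_pow_ge (a j : ℕ) :
    a.factorial ^ 2 * (a + 3 * j).factorial * a ^ (2 * j) ≤
      (a + j).factorial ^ 3 * (a + 3 * j) ^ (2 * j) := by
  have h1 : a.factorial * a ^ j ≤ (a + j).factorial := by
    simpa using Nat.factorial_mul_pow_sub_le_factorial (n := a) (m := a + j) (by omega)
  have h2 : (a + 3 * j).factorial ≤ (a + j).factorial * (a + 3 * j) ^ (2 * j) := by
    have h := Nat.factorial_mul_ascFactorial (a + j) (2 * j)
    rw [show a + j + 2 * j = a + 3 * j by ring] at h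
    rw [← h]
    gcongr
    have := Nat.ascFactorial_le_pow_add (a + j) (2 * j)
    rwa [show a + j + 2 * j = a + 3 * j by ring] at this
  calc a.factorial ^ 2 * (a + 3 * j).factorial * a ^ (2 * j)
      = (a.factorial * a ^ j) ^ 2 * (a + 3 * j).factorial := by ring
    _ ≤ (a + j).factorial ^ 2 * ((a + j).factorial * (a + 3 * j) ^ (2 * j)) := by gcongr
    _ = _ := by ring

theorem half_mul_pow_le (a j : ℕ) (ha : 1 ≤ a) (hj : 12 * j ^ 2 ≤ a + j) :
    (1 / 2 : ℝ) * ((a + 3 * j : ℕ) : ℝ) ^ (2 * j) ≤ (a : ℝ) ^ (2 * j) := by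
  have hN : (0 : ℝ) < a + 3 * j := by positivity
  have hj' : 12 * (j : ℝ) ^ 2 ≤ a + j := by exact_mod_cast hj
  have hle : 3 * (j : ℝ) / (a + 3 * j) ≤ 1 := by
    rw [div_le_one hN]
    linarith [Nat.cast_nonneg (α := ℝ) a]
  have hb := one_add_mul_le_pow (a := -(3 * (j : ℝ) / (a + 3 * j))) (by linarith) (2 * j)
  have hx : 1 + -(3 * (j : ℝ) / (a + 3 * j)) = a / (a + 3 * j) := by
    field_simp
    ring
  have hy : 2 * (j : ℝ) * (3 * j / (a + 3 * j)) ≤ 1 / 2 := by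
    rw [← mul_div_assoc, div_le_iff₀ hN]
    nlinarith [Nat.cast_nonneg (α := ℝ) j]
  rw [hx, div_pow] at hb
  push_cast at hb ⊢
  have : (1 / 2 : ℝ) ≤ a ^ (2 * j) / (a + 3 * j) ^ (2 * j) := by linarith
  rwa [le_div_iff₀ (by positivity)] at this

/-- Trinomial coefficients close to the central one are of order `27 ^ m / m`. -/
theorem pow_div_le_choose_mul_choose (m j : ℕ) (hjm : j < m) (hj : 12 * j ^ 2 ≤ m) :
    (27 : ℝ) ^ m / (9 * m) ≤
      (((3 * m).choose (m - j) * (3 * m - (m - j)).choose (m - j) : ℕ) : ℝ) := by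
  obtain ⟨a, rfl⟩ : ∃ a, m = a + j := ⟨m - j, by omega⟩
  have ha : 1 ≤ a := by omega
  rw [Nat.add_sub_cancel]
  have ht := choose_mul_choose_mul_factorial a (a + 3 * j)
  rw [show 2 * a + (a + 3 * j) = 3 * (a + j) by ring] at ht
  generalize (3 * (a + j)).choose a * (3 * (a + j) - a).choose a = t at ht ⊢
  have h1 := two_mul_pow_mul_factorial_le (a + j) (by omega)
  have h2 := factorial_pow_three_mul_pow_ge a j
  have h3 := half_mul_pow_le a j ha hj
  rw [← ht] at h1
  rw [div_le_iff₀ (by positivity)]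
  have hF : (0 : ℝ) < (a.factorial : ℝ) ^ 2 * (a + 3 * j).factorial := by positivity
  have hP : (0 : ℝ) < ((a + 3 * j : ℕ) : ℝ) ^ (2 * j) := by positivity
  have h1' : 2 * 27 ^ (a + j) * ((a + j).factorial : ℝ) ^ 3 ≤
      9 * ((a + j : ℕ) : ℝ) * (t * (a.factorial * a.factorial * (a + 3 * j).factorial)) := by
    exact_mod_cast h1
  have h2' : (a.factorial : ℝ) ^ 2 * (a + 3 * j).factorial * (a : ℝ) ^ (2 * j) ≤
      ((a + j).factorial : ℝ) ^ 3 * ((a + 3 * j : ℕ) : ℝ) ^ (2 * j) := by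
    exact_mod_cast h2
  have h4 : (1 / 2 : ℝ) * ((a.factorial : ℝ) ^ 2 * (a + 3 * j).factorial) ≤
      ((a + j).factorial : ℝ) ^ 3 := by
    refine le_of_mul_le_mul_right ?_ hP
    calc _ = (a.factorial : ℝ) ^ 2 * (a + 3 * j).factorial *
          (1 / 2 * ((a + 3 * j : ℕ) : ℝ) ^ (2 * j)) := by ring
      _ ≤ _ := (mul_le_mul_of_nonneg_left h3 hF.le).trans h2'
  refine le_of_mul_le_mul_right ?_ hF
  calc _ = 2 * (27 : ℝ) ^ (a + j) *
        (1 / 2 * ((a.factorial : ℝ) ^ 2 * (a + 3 * j).factorial)) := by ring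
    _ ≤ 2 * (27 : ℝ) ^ (a + j) * ((a + j).factorial : ℝ) ^ 3 := by gcongr
    _ ≤ _ := h1'
    _ = _ := by ring

theorem sum_eq_two_mul_of_card_filter_eq {n i : ℕ} {x : Fin n → ℕ}
    (hx : ∀ j, 1 ≤ x j ∧ x j ≤ 3)
    (h1 : (Finset.univ.filter (fun j => x j = 1)).card = i)
    (h3 : (Finset.univ.filter (fun j => x j = 3)).card = i) :
    ∑ j, x j = 2 * n := by
  have key : ∀ j, x j + (if x j = 1 then 1 else 0) = 2 + (if x j = 3 then 1 else 0) := by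
    intro j
    have := hx j
    split_ifs <;> omega
  have hsum := Finset.sum_congr (rfl : (Finset.univ : Finset (Fin n)) = _) fun j _ => key j
  rw [Finset.sum_add_distrib, Finset.sum_add_distrib, ← Finset.card_filter,
    ← Finset.card_filter, h1, h3] at hsum
  simp at hsum
  omega

/-- P(3,n) contains, for n = 3m, an antichain of size ≥ c·3^n/√n, namely the set of
tuples with values in {1,2,3} having, for some 1 ≤ i ≤ m, exactly i coordinates equal
to 1 and exactly i coordinates equal to 3 (the remaining n − 2i coordinates being 2). -/
theorem large_antichain_in_P3 :
    ∃ c : ℝ, 0 < c ∧ ∀ m n : ℕ, 1 ≤ m → n = 3 * m →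
      IsAntichain (· ≤ ·)
        {x : Fin n → ℕ | (∀ j, 1 ≤ x j ∧ x j ≤ 3) ∧
          ∃ i, 1 ≤ i ∧ i ≤ m ∧
            (Finset.univ.filter (fun j => x j = 1)).card = i ∧
            (Finset.univ.filter (fun j => x j = 3)).card = i} ∧
      c * 3 ^ n / Real.sqrt n ≤
        ({x : Fin n → ℕ | (∀ j, 1 ≤ x j ∧ x j ≤ 3) ∧
          ∃ i, 1 ≤ i ∧ i ≤ m ∧
            (Finset.univ.filter (fun j => x j = 1)).card = i ∧
            (Finset.univ.filter (fun j => x j = 3)).card = i}.ncard : ℝ) := by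
  refine ⟨1 / 18, by norm_num, ?_⟩
  rintro m n hm rfl
  constructor
  · rintro x ⟨hx, i, -, -, hx1, hx3⟩ y ⟨hy, k, -, -, hy1, hy3⟩ hne hle
    refine hne (funext fun j => ?_)
    have hsum : ∑ j, x j = ∑ j, y j := by
      rw [sum_eq_two_mul_of_card_filter_eq hx hx1 hx3,
        sum_eq_two_mul_of_card_filter_eq hy hy1 hy3]
    exact (Finset.sum_eq_sum_iff_of_le fun j _ => hle j).1 hsum j (Finset.mem_univ j)
  · set r := Nat.sqrt (m / 12) with hr
    have hj : ∀ j ∈ Finset.range (r + 1), j < m ∧ 12 * j ^ 2 ≤ m := by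
      intro j hj
      have h1 : j ≤ r := Nat.lt_succ_iff.1 (Finset.mem_range.1 hj)
      have h2 : j * j ≤ m / 12 := Nat.le_sqrt.1 h1
      have h3 : 12 * j ^ 2 ≤ m := by
        rw [sq]
        omega
      refine ⟨?_, h3⟩
      rcases Nat.eq_zero_or_pos j with h | h
      · omega
      · nlinarith
    have hcount := sum_choose_mul_choose_le_ncard m (3 * m)
      ((Finset.range (r + 1)).image fun j => m - j) (by
        intro i hi
        obtain ⟨j, hjr, rfl⟩ := Finset.mem_image.1 hi
        have := (hj j hjr).1
        omega)
    rw [Finset.sum_image (by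
      intro j hjr k hkr h
      have := (hj j hjr).1
      have := (hj k hkr).1
      simp only at h
      omega)] at hcount
    refine le_trans ?_ (Nat.cast_le.2 hcount)
    rw [Nat.cast_sum]
    refine le_trans ?_ (Finset.card_nsmul_le_sum _ _ ((27 : ℝ) ^ m / (9 * m)) fun j hjr =>
      pow_div_le_choose_mul_choose m j (hj j hjr).1 (hj j hjr).2)
    have hm0 : (0 : ℝ) < m := by exact_mod_cast hm
    have hrm : (m : ℝ) ≤ 12 * ((r : ℝ) + 1) ^ 2 := by
      have h : m / 12 < (r + 1) * (r + 1) := Nat.lt_succ_sqrt _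
      have h' : m ≤ 12 * (r + 1) ^ 2 := by
        rw [sq]
        omega
      exact_mod_cast h'
    have hsqrt : (m : ℝ) ≤ 2 * ((r : ℝ) + 1) * Real.sqrt ((3 * m : ℕ) : ℝ) := by
      refine (sq_le_sq₀ hm0.le (by positivity)).1 ?_
      rw [mul_pow, Real.sq_sqrt (by positivity)]
      push_cast
      nlinarith
    rw [Finset.card_range, nsmul_eq_mul, pow_mul]
    have hs0 : 0 < Real.sqrt ((3 * m : ℕ) : ℝ) := Real.sqrt_pos.2 (by positivity)
    rw [div_le_iff₀ hs0]
    push_cast at hsqrt ⊢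
    calc 1 / 18 * ((3 : ℝ) ^ 3) ^ m = (27 : ℝ) ^ m / (18 * m) * m := by
          field_simp
          norm_num
      _ ≤ (27 : ℝ) ^ m / (18 * m) * (2 * ((r : ℝ) + 1) * Real.sqrt (3 * m)) := by gcongr
      _ = _ := by
          field_simp
          norm_num
end
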